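/- A set A ⊆ ℕ is low for 1-randomness if and only if A is low for K. That is, every Martin-Löf random element of Cantor space is Martin-Löf random relative to A if and only if there is a constant c such that K(τ) ≤ K^A(τ) + c for all finite binary strings τ. -/

import Mathlib

open MeasureTheory Filter

namespace LMD

/-- Codes for partial functions recursive in an oracle. -/
inductive OracleCode : Type
  | zero : OracleCode
  | succ : OracleCode
  | left : OracleCode
  | right : OracleCode
  | oracle : OracleCode
  | pair : OracleCode → OracleCode → OracleCode
  | comp : OracleCode → OracleCode → OracleCode
  | prec : OracleCode → OracleCode → OracleCode
  | rfind' : OracleCode → OracleCode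

namespace OracleCode

/-- Evaluation of an oracle code relative to a (total) oracle `O : ℕ → ℕ`. -/
def eval (O : ℕ → ℕ) : OracleCode → ℕ →. ℕ
  | zero => pure 0
  | succ => Nat.succ
  | left => ↑fun n : ℕ => n.unpair.1
  | right => ↑fun n : ℕ => n.unpair.2
  | oracle => ↑fun n : ℕ => O n
  | pair cf cg => fun n => Nat.pair <$> eval O cf n <*> eval O cg n
  | comp cf cg => fun n => eval O cg n >>= eval O cf
  | prec cf cg =>
    Nat.unpaired fun a n =>
      n.rec (eval O cf a) fun y IH => do
        let i ← IH
        eval O cg (Nat.pair a (Nat.pair y i))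
  | rfind' cf =>
    Nat.unpaired fun a m =>
      (Nat.rfind fun n => (fun m => m = 0) <$> eval O cf (Nat.pair a (n + m))).map (· + m)

/-- A Gödel numbering of oracle codes. -/
def encodeCode : OracleCode → ℕ
  | zero => 0
  | succ => 1
  | left => 2
  | right => 3
  | oracle => 4
  | pair cf cg => 4 * Nat.pair (encodeCode cf) (encodeCode cg) + 5
  | comp cf cg => 4 * Nat.pair (encodeCode cf) (encodeCode cg) + 6
  | prec cf cg => 4 * Nat.pair (encodeCode cf) (encodeCode cg) + 7
  | rfind' cf => 4 * encodeCode cf + 8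

end OracleCode

/-- `f` is partial recursive in the oracle `O`. -/
def RecursiveIn (O : ℕ → ℕ) (f : ℕ →. ℕ) : Prop := ∃ c : OracleCode, c.eval O = f

/-- The characteristic function of a set of naturals. -/
noncomputable def chi (A : Set ℕ) : ℕ → ℕ := A.indicator fun _ => 1

/-- Turing reducibility between sets of naturals. -/
def TuringLE (A B : Set ℕ) : Prop := RecursiveIn (chi B) (chi A)

/-- The Turing jump of a set of naturals. -/
def jump (B : Set ℕ) : Set ℕ :=
  {e | ∃ c : OracleCode, c.encodeCode = e ∧ (c.eval (chi B) e).Dom}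

/-- The open subset of Cantor space generated by a set of finite binary strings. -/
def Cyl (W : Set (List Bool)) : Set (ℕ → Bool) :=
  {X | ∃ σ ∈ W, ∀ i : Fin σ.length, X i = σ.get i}

/-- The fair-coin product measure on Cantor space, realized as the pushforward of
Lebesgue measure on `[0,1)` under the binary expansion map. -/
noncomputable def mu : Measure (ℕ → Bool) :=
  Measure.map (fun x n => decide (⌊x * 2 ^ (n + 1)⌋₊ % 2 = 1))
    (volume.restrict (Set.Ico (0 : ℝ) 1))

/-- `W` is a c.e.-in-`A` set of binary strings. -/
def CeIn (A : Set ℕ) (W : Set (List Bool)) : Prop :=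
  ∃ c : OracleCode, ∀ σ : List Bool, σ ∈ W ↔ (c.eval (chi A) (Encodable.encode σ)).Dom

/-- `W` is a uniformly c.e.-in-`A` sequence of sets of binary strings. -/
def CeSeqIn (A : Set ℕ) (W : ℕ → Set (List Bool)) : Prop :=
  ∃ c : OracleCode, ∀ (n : ℕ) (σ : List Bool),
    σ ∈ W n ↔ (c.eval (chi A) (Nat.pair n (Encodable.encode σ))).Dom

/-- A Martin-Löf test relative to `A`. -/
def MLTest (A : Set ℕ) (U : ℕ → Set (ℕ → Bool)) : Prop :=
  ∃ W : ℕ → Set (List Bool), CeSeqIn A W ∧ (∀ n, U n = Cyl (W n)) ∧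
    (∀ n, U (n + 1) ⊆ U n) ∧ ∀ n, mu (U n) ≤ 2⁻¹ ^ n

/-- `X` is Martin-Löf random relative to `A`. -/
def MLRandom (A : Set ℕ) (X : ℕ → Bool) : Prop :=
  ∀ U : ℕ → Set (ℕ → Bool), MLTest A U → X ∉ ⋂ n, U n

/-- `A ≤_LR B`: every `B`-random is `A`-random. -/
def LRle (A B : Set ℕ) : Prop := ∀ X : ℕ → Bool, MLRandom B X → MLRandom A X

/-- Evaluation of an oracle machine on binary strings. -/
def evalStr (c : OracleCode) (O : ℕ → ℕ) (σ : List Bool) : Part (List Bool) :=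
  (c.eval O (Encodable.encode σ)).bind fun m => Part.ofOption (Encodable.decode m)

/-- `c` is a prefix-free oracle machine: for every oracle its domain is prefix-free. -/
def PrefixFreeMachine (c : OracleCode) : Prop :=
  ∀ (O : ℕ → ℕ) (σ₁ σ₂ : List Bool), σ₁ <+: σ₂ →
    (evalStr c O σ₁).Dom → (evalStr c O σ₂).Dom → σ₁ = σ₂

/-- `u` is a universal prefix-free oracle machine. -/
def UniversalPFM (u : OracleCode) : Prop :=
  PrefixFreeMachine u ∧
    ∀ c : OracleCode, PrefixFreeMachine c → ∃ d : ℕ, ∀ (O : ℕ → ℕ) (σ τ : List Bool),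
      τ ∈ evalStr c O σ → ∃ σ' : List Bool, τ ∈ evalStr u O σ' ∧ σ'.length ≤ σ.length + d

/-- Prefix-free Kolmogorov complexity relative to the oracle `O`,
measured by the universal machine `u` (`⊤` if `τ` is not in the range). -/
noncomputable def K (u : OracleCode) (O : ℕ → ℕ) (τ : List Bool) : ℕ∞ :=
  ⨅ σ ∈ {σ : List Bool | τ ∈ evalStr u O σ}, (σ.length : ℕ∞)

/-- `A ≤_LK B` with respect to the universal machine `u`. -/
def LKle (u : OracleCode) (A B : Set ℕ) : Prop :=
  ∃ d : ℕ, ∀ τ : List Bool, K u (chi B) τ ≤ K u (chi A) τ + (d : ℕ∞)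


section

open MeasureTheory Filter
open scoped NNReal ENNReal

/-! ### Bounded quantifiers and primitive recursion -/

theorem primrecPred_forall_mem {α β : Type*} [Primcodable α] [Primcodable β] {f : α → List β}
    {p : α → β → Prop} (hf : Primrec f) (hp : PrimrecRel p) :
    PrimrecPred fun a => ∀ x ∈ f a, p a x :=
  (PrimrecRel.forall_mem_list (R := fun (x : β) (a : α) => p a x) hp.swap).comp hf Primrec.id

theorem primrecPred_exists_mem {α β : Type*} [Primcodable α] [Primcodable β] {f : α → List β}
    {p : α → β → Prop} (hf : Primrec f) (hp : PrimrecRel p) :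
    PrimrecPred fun a => ∃ x ∈ f a, p a x :=
  (PrimrecRel.exists_mem_list (R := fun (x : β) (a : α) => p a x) hp.swap).comp hf Primrec.id

theorem primrecPred_exists_lt {α : Type*} [Primcodable α] {f : α → ℕ} {p : α → ℕ → Prop}
    (hf : Primrec f) (hp : PrimrecRel p) : PrimrecPred fun a => ∃ x < f a, p a x :=
  (primrecPred_exists_mem (Primrec.list_range.comp hf) hp).of_eq fun a => by simp

theorem primrecPred_forall_lt {α : Type*} [Primcodable α] {f : α → ℕ} {p : α → ℕ → Prop}
    (hf : Primrec f) (hp : PrimrecRel p) : PrimrecPred fun a => ∀ x < f a, p a x :=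
  (primrecPred_forall_mem (Primrec.list_range.comp hf) hp).of_eq fun a => by simp

/-- The initial segment of length `n` of a sequence. -/
def pre {α : Type*} (X : ℕ → α) (n : ℕ) : List α := (List.range n).map X

section pre
variable {α : Type*} (X : ℕ → α)

@[simp] theorem length_pre (n : ℕ) : (pre X n).length = n := by simp [pre]

theorem take_pre {m n : ℕ} (h : m ≤ n) : (pre X n).take m = pre X m := by
  simp [pre, ← List.map_take, List.take_range, h]

theorem getElem?_pre {m n : ℕ} (h : m < n) : (pre X n)[m]? = some (X m) := by
  simp [pre, h]

theorem pre_succ (n : ℕ) : pre X (n + 1) = pre X n ++ [X n] := by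
  simp [pre, List.range_succ]

end pre

/-! ### Finite-use approximations of oracle computations -/

/-- A primitive recursive approximation with finite oracle use. -/
structure Approx (φ : (ℕ → ℕ) → ℕ → Part ℕ) (f : List ℕ → ℕ → Option ℕ) : Prop where
  primrec : Primrec₂ f
  mono : ∀ (O : ℕ → ℕ) {s t : ℕ} (n x : ℕ), s ≤ t → f (pre O s) n = some x →
    f (pre O t) n = some x
  spec : ∀ (O : ℕ → ℕ) (n x : ℕ), x ∈ φ O n ↔ ∃ s, f (pre O s) n = some x

theorem approx_of_primrec {g : ℕ → ℕ} (hg : Primrec g) :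
    Approx (fun _ => (g : ℕ →. ℕ)) fun _ n => some (g n) where
  primrec := Primrec.option_some.comp (hg.comp Primrec.snd)
  mono := by simp
  spec := by
    intro O n x
    simp [PFun.coe_val, eq_comm]

theorem approx_oracle : Approx (fun O => (fun n => O n : ℕ →. ℕ)) fun l n => l[n]? where
  primrec := Primrec.list_getElem?
  mono := by
    intro O s t n x hst h
    by_cases hn : n < s
    · rw [getElem?_pre _ hn] at h
      rw [getElem?_pre _ (hn.trans_le hst), h]
    · rw [List.getElem?_eq_none (by simpa using hn)] at h
      cases h
  spec := by
    intro O n x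
    constructor
    · intro h
      refine ⟨n + 1, ?_⟩
      rw [getElem?_pre _ (Nat.lt_succ_self n)]
      simpa [PFun.coe_val, eq_comm] using h
    · rintro ⟨s, h⟩
      have hn : n < s := by
        by_contra hn
        rw [List.getElem?_eq_none (by simpa using hn)] at h
        cases h
      rw [getElem?_pre _ hn] at h
      simpa [PFun.coe_val, eq_comm] using h

theorem Approx.pair {φ ψ : (ℕ → ℕ) → ℕ → Part ℕ} {f g : List ℕ → ℕ → Option ℕ} (hf : Approx φ f)
    (hg : Approx ψ g) : Approx (fun O n => Nat.pair <$> φ O n <*> ψ O n)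
      fun l n => (f l n).bind fun a => (g l n).map (Nat.pair a) where
  primrec := by
    refine Primrec.option_bind hf.primrec ?_
    refine Primrec.option_map (hg.primrec.comp (Primrec.fst.comp Primrec.fst)
      (Primrec.snd.comp Primrec.fst)) ?_
    exact Primrec₂.natPair.comp (Primrec.snd.comp Primrec.fst) Primrec.snd
  mono := by
    intro O s t n x hst h
    simp only [Option.bind_eq_some_iff, Option.map_eq_some_iff] at h ⊢
    obtain ⟨a, ha, b, hb, rfl⟩ := h
    exact ⟨a, hf.mono O _ _ hst ha, b, hg.mono O _ _ hst hb, rfl⟩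
  spec := by
    intro O n x
    change x ∈ ((φ O n).map Nat.pair).bind (fun h => (ψ O n).map h) ↔ _
    simp only [Option.bind_eq_some_iff, Option.map_eq_some_iff, Part.mem_bind_iff,
      Part.mem_map_iff, hf.spec, hg.spec]
    constructor
    · rintro ⟨_, ⟨a, ⟨s, ha⟩, rfl⟩, b, ⟨t, hb⟩, rfl⟩
      exact ⟨max s t, a, hf.mono O _ _ (le_max_left _ _) ha, b,
        hg.mono O _ _ (le_max_right _ _) hb, rfl⟩
    · rintro ⟨s, a, ha, b, hb, rfl⟩
      exact ⟨_, ⟨a, ⟨s, ha⟩, rfl⟩, b, ⟨s, hb⟩, rfl⟩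

theorem Approx.comp {φ ψ : (ℕ → ℕ) → ℕ → Part ℕ} {f g : List ℕ → ℕ → Option ℕ} (hf : Approx φ f)
    (hg : Approx ψ g) : Approx (fun O n => ψ O n >>= φ O)
      fun l n => (g l n).bind (f l) where
  primrec := Primrec.option_bind hg.primrec
    (hf.primrec.comp (Primrec.fst.comp Primrec.fst) Primrec.snd)
  mono := by
    intro O s t n x hst h
    simp only [Option.bind_eq_some_iff] at h ⊢
    obtain ⟨a, ha, hb⟩ := h
    exact ⟨a, hg.mono O _ _ hst ha, hf.mono O _ _ hst hb⟩
  spec := by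
    intro O n x
    change x ∈ (ψ O n).bind (φ O) ↔ _
    simp only [Option.bind_eq_some_iff, Part.mem_bind_iff, hf.spec, hg.spec]
    constructor
    · rintro ⟨a, ⟨s, ha⟩, t, hb⟩
      exact ⟨max s t, a, hg.mono O _ _ (le_max_left _ _) ha,
        hf.mono O _ _ (le_max_right _ _) hb⟩
    · rintro ⟨s, a, ha, hb⟩
      exact ⟨a, ⟨s, ha⟩, s, hb⟩

theorem Approx.prec {φ ψ : (ℕ → ℕ) → ℕ → Part ℕ} {f g : List ℕ → ℕ → Option ℕ} (hf : Approx φ f)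
    (hg : Approx ψ g) :
    Approx (fun O => Nat.unpaired fun a n => n.rec (φ O a) fun y IH => do
        let i ← IH
        ψ O (Nat.pair a (Nat.pair y i)))
      fun l m => m.unpair.2.rec (f l m.unpair.1) fun y IH =>
        IH.bind fun i => g l (Nat.pair m.unpair.1 (Nat.pair y i)) where
  primrec := by
    refine Primrec.nat_rec' (h := fun p q => q.2.bind fun i =>
      g p.1 (Nat.pair p.2.unpair.1 (Nat.pair q.1 i))) (Primrec.snd.comp (Primrec.unpair.comp Primrec.snd))
      (hf.primrec.comp Primrec.fst (Primrec.fst.comp (Primrec.unpair.comp Primrec.snd))) ?_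
    refine Primrec.option_bind (Primrec.snd.comp Primrec.snd) ?_
    refine hg.primrec.comp (Primrec.fst.comp (Primrec.fst.comp Primrec.fst)) ?_
    exact Primrec₂.natPair.comp
      (Primrec.fst.comp (Primrec.unpair.comp (Primrec.snd.comp (Primrec.fst.comp Primrec.fst))))
      (Primrec₂.natPair.comp (Primrec.fst.comp (Primrec.snd.comp Primrec.fst)) Primrec.snd)
  mono := by
    intro O s t m x hst
    generalize m.unpair.1 = a
    induction m.unpair.2 generalizing x with
    | zero => exact hf.mono O _ _ hst
    | succ y ih =>
      intro h
      simp only [Option.bind_eq_some_iff] at h ⊢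
      obtain ⟨i, hi, h⟩ := h
      exact ⟨i, ih _ hi, hg.mono O _ _ hst h⟩
  spec := by
    intro O m x
    simp only [Nat.unpaired]
    generalize m.unpair.1 = a
    have mono : ∀ (k x : ℕ) {s t : ℕ}, s ≤ t →
        (k.rec (f (pre O s) a) fun y IH =>
          IH.bind fun i => g (pre O s) (Nat.pair a (Nat.pair y i)) : Option ℕ) = some x →
        (k.rec (f (pre O t) a) fun y IH =>
          IH.bind fun i => g (pre O t) (Nat.pair a (Nat.pair y i)) : Option ℕ) = some x := by
      intro k x s t hst
      induction k generalizing x with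
      | zero => exact hf.mono O _ _ hst
      | succ y ih =>
        intro h
        simp only [Option.bind_eq_some_iff] at h ⊢
        obtain ⟨i, hi, h⟩ := h
        exact ⟨i, ih _ hi, hg.mono O _ _ hst h⟩
    induction m.unpair.2 generalizing x with
    | zero => exact hf.spec O a x
    | succ y ih =>
      change x ∈ (Part.bind _ fun i => ψ O (Nat.pair a (Nat.pair y i))) ↔ _
      simp only [Part.mem_bind_iff, Option.bind_eq_some_iff, ih, hg.spec]
      constructor
      · rintro ⟨i, ⟨s, hi⟩, t, h⟩
        exact ⟨max s t, i, mono y i (le_max_left _ _) hi, hg.mono O _ _ (le_max_right _ _) h⟩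
      · rintro ⟨s, i, hi, h⟩
        exact ⟨i, ⟨s, hi⟩, s, h⟩

/-- Bounded search: the least `k < b` with `p k = some 0`, provided that `p` is defined
below `k`. -/
def boundedSearch (p : ℕ → Option ℕ) : ℕ → Option ℕ
  | 0 => none
  | b + 1 => (boundedSearch p b).or
      (if p b = some 0 ∧ ∀ j < b, (p j).isSome ∧ p j ≠ some 0 then some b else none)

theorem boundedSearch_eq_some {p : ℕ → Option ℕ} {b k : ℕ} :
    boundedSearch p b = some k ↔
      k < b ∧ p k = some 0 ∧ ∀ j < k, (p j).isSome ∧ p j ≠ some 0 := by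
  induction b generalizing k with
  | zero => simp [boundedSearch]
  | succ b ih =>
    rw [boundedSearch, Option.or_eq_some_iff]
    constructor
    · rintro (h | ⟨-, h⟩)
      · obtain ⟨h1, h2⟩ := ih.1 h
        exact ⟨h1.trans (Nat.lt_succ_self b), h2⟩
      · split_ifs at h with hb
        obtain rfl : b = k := by simpa using h
        exact ⟨Nat.lt_succ_self _, hb⟩
    · rintro ⟨h1, h2, h3⟩
      rcases Nat.lt_succ_iff_lt_or_eq.1 h1 with h | rfl
      · exact Or.inl (ih.2 ⟨h, h2, h3⟩)
      · refine Or.inr ⟨?_, by rw [if_pos ⟨h2, h3⟩]⟩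
        rw [Option.eq_none_iff_forall_ne_some]
        intro j hj
        obtain ⟨hj, h0, -⟩ := ih.1 hj
        exact (h3 j hj).2 h0

theorem primrec_boundedSearch {α : Type*} [Primcodable α] {p : α → ℕ → Option ℕ} {b : α → ℕ}
    (hp : Primrec₂ p) (hb : Primrec b) : Primrec fun a => boundedSearch (p a) (b a) := by
  have : Primrec fun a => ((b a).rec (none : Option ℕ) fun k IH => IH.or
      (if p a k = some 0 ∧ ∀ j < k, (p a j).isSome ∧ p a j ≠ some 0 then some k else none) : Option ℕ) := by
    refine Primrec.nat_rec' (h := fun a q => q.2.or (if p a q.1 = some 0 ∧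
      ∀ j < q.1, (p a j).isSome ∧ p a j ≠ some 0 then some q.1 else none)) hb
      (Primrec.const none) ?_
    have : Primrec₂ (Option.or : Option ℕ → Option ℕ → Option ℕ) :=
      Primrec.option_orElse.of_eq fun a b => by cases a <;> rfl
    refine this.comp (Primrec.snd.comp Primrec.snd) (Primrec.ite ?_
      (Primrec.option_some.comp (Primrec.fst.comp Primrec.snd)) (Primrec.const none))
    refine PrimrecPred.and (Primrec.eq.comp (hp.comp Primrec.fst (Primrec.fst.comp Primrec.snd))
      (Primrec.const _)) (primrecPred_forall_lt (Primrec.fst.comp Primrec.snd) ?_)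
    have h : Primrec fun q : (α × ℕ × Option ℕ) × ℕ => p q.1.1 q.2 :=
      hp.comp (Primrec.fst.comp Primrec.fst) Primrec.snd
    exact PrimrecPred.and (Primrec.eq.comp (Primrec.option_isSome.comp h) (Primrec.const true))
      (PrimrecPred.not (Primrec.eq.comp h (Primrec.const _)))
  refine this.of_eq fun a => ?_
  induction b a with
  | zero => rfl
  | succ k ih => simp only [boundedSearch, ih]

theorem Approx.rfind {φ : (ℕ → ℕ) → ℕ → Part ℕ} {f : List ℕ → ℕ → Option ℕ} (hf : Approx φ f) :
    Approx (fun O => Nat.unpaired fun a m =>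
        (Nat.rfind fun n => (fun m => m = 0) <$> φ O (Nat.pair a (n + m))).map (· + m))
      fun l n => (boundedSearch (fun k => f l (Nat.pair n.unpair.1 (k + n.unpair.2)))
        l.length).map (· + n.unpair.2) where
  primrec := by
    refine Primrec.option_map (primrec_boundedSearch ?_ (Primrec.list_length.comp Primrec.fst)) ?_
    · refine hf.primrec.comp (Primrec.fst.comp Primrec.fst) (Primrec₂.natPair.comp ?_ ?_)
      · exact Primrec.fst.comp (Primrec.unpair.comp (Primrec.snd.comp Primrec.fst))
      · exact Primrec.nat_add.comp Primrec.snd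
          (Primrec.snd.comp (Primrec.unpair.comp (Primrec.snd.comp Primrec.fst)))
    · exact Primrec.nat_add.comp Primrec.snd
          (Primrec.snd.comp (Primrec.unpair.comp (Primrec.snd.comp Primrec.fst)))
  mono := by
    intro O s t m x hst
    simp only [Option.map_eq_some_iff, boundedSearch_eq_some, length_pre]
    rintro ⟨k, ⟨h1, h2, h3⟩, rfl⟩
    refine ⟨k, ⟨h1.trans_le hst, hf.mono O _ _ hst h2, fun j hj => ?_⟩, rfl⟩
    obtain ⟨h4, h5⟩ := h3 j hj
    obtain ⟨y, hy⟩ := Option.isSome_iff_exists.1 h4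
    rw [hf.mono O _ _ hst hy, ← hy]
    exact ⟨h4, h5⟩
  spec := by
    intro O m x
    simp only [Nat.unpaired]
    generalize m.unpair.1 = a
    generalize m.unpair.2 = m
    change x ∈ ((Nat.rfind fun n => (φ O (Nat.pair a (n + m))).map fun m =>
      decide (m = 0)).map (· + m)) ↔ _
    have hrf : ∀ k, k ∈ Nat.rfind (fun n => (φ O (Nat.pair a (n + m))).map fun m =>
        decide (m = 0)) ↔
        (∃ y, (∃ s, f (pre O s) (Nat.pair a (k + m)) = some y) ∧ decide (y = 0) = true) ∧
        ∀ {j : ℕ}, j < k →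
          ∃ y, (∃ s, f (pre O s) (Nat.pair a (j + m)) = some y) ∧ decide (y = 0) = false := by
      intro k
      refine Nat.mem_rfind.trans ?_
      simp only [Part.mem_map_iff, hf.spec]
    simp only [Part.mem_map_iff, Option.map_eq_some_iff, boundedSearch_eq_some, length_pre, hrf]
    constructor
    · rintro ⟨k, ⟨⟨y, ⟨s, hs⟩, hy⟩, h2⟩, rfl⟩
      obtain rfl : y = 0 := by simpa using hy
      have : ∀ j, ∃ s, j < k → (f (pre O s) (Nat.pair a (j + m))).isSome ∧
          f (pre O s) (Nat.pair a (j + m)) ≠ some 0 := by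
        intro j
        by_cases hj : j < k
        · obtain ⟨y, ⟨s, hs⟩, hy⟩ := h2 hj
          refine ⟨s, fun _ => ?_⟩
          rw [hs]
          simpa using hy
        · exact ⟨0, fun h => absurd h hj⟩
      choose S hS using this
      set T := max (k + 1) (max s ((Finset.range k).sup S)) with hT
      refine ⟨T, k, ⟨by omega, hf.mono O _ _ (by omega) hs, fun j hj => ?_⟩, rfl⟩
      obtain ⟨h4, h5⟩ := hS j hj
      have hle : S j ≤ T := by
        have := Finset.le_sup (f := S) (Finset.mem_range.2 hj)
        omega
      obtain ⟨y, hy⟩ := Option.isSome_iff_exists.1 h4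
      rw [hf.mono O _ _ hle hy, ← hy]
      exact ⟨h4, h5⟩
    · rintro ⟨s, k, ⟨h1, h2, h3⟩, rfl⟩
      refine ⟨k, ⟨⟨0, ⟨s, h2⟩, by simp⟩, fun {j} hj => ?_⟩, rfl⟩
      obtain ⟨h4, h5⟩ := h3 j hj
      obtain ⟨y, hy⟩ := Option.isSome_iff_exists.1 h4
      refine ⟨y, ⟨s, hy⟩, ?_⟩
      rw [hy] at h5
      simpa using h5

theorem OracleCode.exists_approx (c : OracleCode) : ∃ f, Approx (fun O => c.eval O) f := by
  induction c with
  | zero => exact ⟨_, approx_of_primrec (Primrec.const 0)⟩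
  | succ => exact ⟨_, approx_of_primrec Primrec.succ⟩
  | left => exact ⟨_, approx_of_primrec (Primrec.fst.comp Primrec.unpair)⟩
  | right => exact ⟨_, approx_of_primrec (Primrec.snd.comp Primrec.unpair)⟩
  | oracle => exact ⟨_, approx_oracle⟩
  | pair cf cg hf hg =>
    obtain ⟨f, hf⟩ := hf
    obtain ⟨g, hg⟩ := hg
    exact ⟨_, hf.pair hg⟩
  | comp cf cg hf hg =>
    obtain ⟨f, hf⟩ := hf
    obtain ⟨g, hg⟩ := hg
    exact ⟨_, hf.comp hg⟩
  | prec cf cg hf hg =>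
    obtain ⟨f, hf⟩ := hf
    obtain ⟨g, hg⟩ := hg
    exact ⟨_, hf.prec hg⟩
  | rfind' cf hf =>
    obtain ⟨f, hf⟩ := hf
    exact ⟨_, hf.rfind⟩

/-! ### Oracle codes for searches through finite oracle prefixes -/

/-- The code `c` computes the total functional `F`, uniformly in the oracle. -/
def Computes (c : OracleCode) (F : (ℕ → ℕ) → ℕ → ℕ) : Prop :=
  ∀ O n, c.eval O n = Part.some (F O n)

theorem Computes.pair {c d : OracleCode} {F G : (ℕ → ℕ) → ℕ → ℕ} (hc : Computes c F)
    (hd : Computes d G) : Computes (c.pair d) fun O n => Nat.pair (F O n) (G O n) := by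
  intro O n
  change ((c.eval O n).map Nat.pair).bind (fun h => (d.eval O n).map h) = _
  rw [hc, hd]
  simp

theorem Computes.comp {c d : OracleCode} {F G : (ℕ → ℕ) → ℕ → ℕ} (hc : Computes c F)
    (hd : Computes d G) : Computes (c.comp d) fun O n => F O (G O n) := by
  intro O n
  change (d.eval O n).bind (fun m => c.eval O m) = _
  rw [hd, Part.bind_some, hc]

theorem Computes.prec {c d : OracleCode} {F G : (ℕ → ℕ) → ℕ → ℕ} (hc : Computes c F)
    (hd : Computes d G) : Computes (c.prec d) fun O n =>
      n.unpair.2.rec (F O n.unpair.1) fun y IH => G O (Nat.pair n.unpair.1 (Nat.pair y IH)) := by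
  intro O n
  simp only [OracleCode.eval, Nat.unpaired]
  generalize n.unpair.1 = a
  induction n.unpair.2 with
  | zero => exact hc O a
  | succ y ih =>
    change Part.bind _ (fun i => d.eval O (Nat.pair a (Nat.pair y i))) = _
    rw [ih, Part.bind_some, hd]

theorem computes_oracle : Computes .oracle fun O n => O n := fun _ _ => rfl

theorem exists_computes_of_natPrimrec {f : ℕ → ℕ} (hf : Nat.Primrec f) :
    ∃ c, Computes c fun _ => f := by
  induction hf with
  | zero => exact ⟨.zero, fun _ _ => rfl⟩
  | succ => exact ⟨.succ, fun _ _ => rfl⟩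
  | left => exact ⟨.left, fun _ _ => rfl⟩
  | right => exact ⟨.right, fun _ _ => rfl⟩
  | pair _ _ hf hg =>
    obtain ⟨c, hc⟩ := hf
    obtain ⟨d, hd⟩ := hg
    exact ⟨_, hc.pair hd⟩
  | comp _ _ hf hg =>
    obtain ⟨c, hc⟩ := hf
    obtain ⟨d, hd⟩ := hg
    exact ⟨_, hc.comp hd⟩
  | prec _ _ hf hg =>
    obtain ⟨c, hc⟩ := hf
    obtain ⟨d, hd⟩ := hg
    exact ⟨_, hc.prec hd⟩

theorem exists_computes_of_primrec {f : ℕ → ℕ} (hf : Primrec f) : ∃ c, Computes c fun _ => f :=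
  exists_computes_of_natPrimrec (Primrec.nat_iff.1 hf)

theorem exists_computes_pre : ∃ c, Computes c fun O n => Encodable.encode (pre O n) := by
  have h1 : Primrec fun n : ℕ => Encodable.encode
      (((Encodable.decode (α := List ℕ) n.unpair.1).getD []) ++ [n.unpair.2]) :=
    Primrec.encode.comp (Primrec.list_concat.comp (Primrec.option_getD.comp
      (Primrec.decode.comp (Primrec.fst.comp Primrec.unpair)) (Primrec.const []))
      (Primrec.snd.comp Primrec.unpair))
  have hY : Primrec fun n : ℕ => n.unpair.2.unpair.1 :=
    Primrec.fst.comp (Primrec.unpair.comp (Primrec.snd.comp Primrec.unpair))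
  have hI : Primrec fun n : ℕ => n.unpair.2.unpair.2 :=
    Primrec.snd.comp (Primrec.unpair.comp (Primrec.snd.comp Primrec.unpair))
  obtain ⟨cApp, hApp⟩ := exists_computes_of_primrec h1
  obtain ⟨cY, hcY⟩ := exists_computes_of_primrec hY
  obtain ⟨cI, hcI⟩ := exists_computes_of_primrec hI
  obtain ⟨cNil, hNil⟩ := exists_computes_of_primrec
    (Primrec.const (α := ℕ) (Encodable.encode ([] : List ℕ)))
  obtain ⟨cArg, hArg⟩ := exists_computes_of_primrec
    (Primrec₂.natPair.comp (Primrec.const 0) Primrec.id : Primrec fun n : ℕ => Nat.pair 0 n)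
  refine ⟨_, fun O n => ((hNil.prec (hApp.comp (hcI.pair (computes_oracle.comp hcY)))).comp
    hArg O n).trans ?_⟩
  simp only [Nat.unpair_pair]
  congr 1
  induction n with
  | zero => rfl
  | succ n ih =>
    simp only [ih, Encodable.encodek, Option.getD_some, pre_succ]

theorem exists_code_rfindOpt {g : List ℕ → ℕ → Option ℕ} (hg : Primrec₂ g) :
    ∃ c : OracleCode, ∀ O n, c.eval O n = Nat.rfindOpt fun s => g (pre O s) n := by
  obtain ⟨cPre, hPre⟩ := exists_computes_pre
  have hG : Primrec fun m : ℕ =>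
      g ((Encodable.decode (α := List ℕ) m.unpair.2).getD []) m.unpair.1 :=
    hg.comp (Primrec.option_getD.comp
      (Primrec.decode.comp (Primrec.snd.comp Primrec.unpair)) (Primrec.const []))
      (Primrec.fst.comp Primrec.unpair)
  have hT : Primrec fun m : ℕ => if (g ((Encodable.decode (α := List ℕ) m.unpair.2).getD [])
      m.unpair.1).isSome = true then 0 else 1 :=
    Primrec.ite (Primrec.eq.comp (Primrec.option_isSome.comp hG) (Primrec.const true))
      (Primrec.const 0) (Primrec.const 1)
  have hV : Primrec fun m : ℕ => (g ((Encodable.decode (α := List ℕ) m.unpair.2).getD [])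
      m.unpair.1).getD 0 := Primrec.option_getD.comp hG (Primrec.const 0)
  obtain ⟨cT, hcT⟩ := exists_computes_of_primrec hT
  obtain ⟨cV, hcV⟩ := exists_computes_of_primrec hV
  obtain ⟨cId, hId⟩ := exists_computes_of_primrec (Primrec.id (α := ℕ))
  obtain ⟨cFst, hFst⟩ := exists_computes_of_primrec (Primrec.fst.comp Primrec.unpair)
  obtain ⟨cSnd, hSnd⟩ := exists_computes_of_primrec (Primrec.snd.comp Primrec.unpair)
  obtain ⟨cZ, hZ⟩ := exists_computes_of_primrec (Primrec.const (α := ℕ) 0)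
  have ht := hcT.comp (hFst.pair (hPre.comp hSnd))
  have hv := hcV.comp (hFst.pair (hPre.comp hSnd))
  set t := cT.comp (cFst.pair (cPre.comp cSnd))
  set v := cV.comp (cFst.pair (cPre.comp cSnd))
  refine ⟨v.comp (cId.pair (t.rfind'.comp (cId.pair cZ))), fun O n => ?_⟩
  have hs : (t.rfind'.comp (cId.pair cZ)).eval O n =
      Nat.rfind fun s => ((g (pre O s) n).isSome : Part Bool) := by
    change ((cId.pair cZ).eval O n).bind (fun m => t.rfind'.eval O m) = _
    rw [hId.pair hZ, Part.bind_some]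
    simp only [OracleCode.eval, Nat.unpaired, Nat.unpair_pair, id, Nat.add_zero]
    have : (fun k => (fun m : ℕ => decide (m = 0)) <$> t.eval O (Nat.pair n k)) =
        fun s => ((g (pre O s) n).isSome : Part Bool) := by
      funext k
      rw [ht]
      simp only [Nat.unpair_pair, Encodable.encodek, Option.getD_some, Part.map_eq_map,
        Part.map_some]
      cases (g (pre O k) n).isSome <;> simp
    rw [this]
    exact Part.map_id' (fun _ => rfl) _
  change (((cId.eval O n).map Nat.pair).bind
    fun h => ((t.rfind'.comp (cId.pair cZ)).eval O n).map h).bind (fun m => v.eval O m) = _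
  rw [hId, hs]
  simp only [id, Part.map_some, Part.bind_some, Nat.rfindOpt, Part.bind_map]
  ext x
  simp only [Part.mem_bind_iff]
  refine exists_congr fun s => and_congr_right fun h => ?_
  have hsome : (g (pre O s) n).isSome := by
    have := Nat.rfind_spec h
    simpa using this
  obtain ⟨y, hy⟩ := Option.isSome_iff_exists.1 hsome
  rw [hv]
  simp [hy]

/-! ### Approximations of machines and of computably enumerable sequences -/

theorem exists_approx_evalStr (c : OracleCode) : ∃ f : List ℕ → List Bool → Option (List Bool),
    Primrec₂ f ∧
    (∀ (O : ℕ → ℕ) {s t : ℕ} (σ τ : List Bool), s ≤ t → f (pre O s) σ = some τ →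
      f (pre O t) σ = some τ) ∧
    ∀ (O : ℕ → ℕ) (σ τ : List Bool), τ ∈ evalStr c O σ ↔ ∃ s, f (pre O s) σ = some τ := by
  obtain ⟨f, hf⟩ := c.exists_approx
  refine ⟨fun l σ => (f l (Encodable.encode σ)).bind Encodable.decode, ?_, ?_, ?_⟩
  · exact Primrec.option_bind (hf.primrec.comp Primrec.fst (Primrec.encode.comp Primrec.snd))
      (Primrec.decode.comp Primrec.snd)
  · intro O s t σ τ hst h
    simp only [Option.bind_eq_some_iff] at h ⊢
    obtain ⟨a, ha, h⟩ := h
    exact ⟨a, hf.mono O _ _ hst ha, h⟩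
  · intro O σ τ
    simp only [evalStr, Part.mem_bind_iff, Part.mem_ofOption, Option.bind_eq_some_iff,
      hf.spec, Option.mem_def]
    exact ⟨fun ⟨a, ⟨s, h⟩, h'⟩ => ⟨s, a, h, h'⟩, fun ⟨s, a, h, h'⟩ => ⟨a, ⟨s, h⟩, h'⟩⟩

theorem exists_machine {m : List ℕ → List Bool → Option (List Bool)} (hm : Primrec₂ m) :
    ∃ c : OracleCode, ∀ O σ, evalStr c O σ = Nat.rfindOpt fun s => m (pre O s) σ := by
  have hg : Primrec₂ fun (l : List ℕ) (n : ℕ) =>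
      ((Encodable.decode (α := List Bool) n).bind fun σ => m l σ).map Encodable.encode :=
    Primrec.option_map (Primrec.option_bind (Primrec.decode.comp Primrec.snd)
      (hm.comp (Primrec.fst.comp Primrec.fst) Primrec.snd)) (Primrec.encode.comp Primrec.snd)
  obtain ⟨c, hc⟩ := exists_code_rfindOpt hg
  refine ⟨c, fun O σ => ?_⟩
  rw [evalStr, hc]
  simp only [Encodable.encodek, Option.bind_some, Nat.rfindOpt, Option.isSome_map]
  ext τ
  simp only [Part.mem_bind_iff, Part.mem_ofOption, Option.mem_def,
    Option.map_eq_some_iff]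
  constructor
  · rintro ⟨_, ⟨s, hs, ρ, hρ, rfl⟩, h⟩
    rw [Encodable.encodek] at h
    exact ⟨s, hs, hρ.trans h⟩
  · rintro ⟨s, hs, h⟩
    exact ⟨_, ⟨s, hs, τ, h, rfl⟩, Encodable.encodek τ⟩

theorem CeSeqIn.exists_stage {A : Set ℕ} {W : ℕ → Set (List Bool)} (h : CeSeqIn A W) :
    ∃ Q : List ℕ → ℕ → List Bool → Prop,
      PrimrecPred (fun p : List ℕ × ℕ × List Bool => Q p.1 p.2.1 p.2.2) ∧
      (∀ (O : ℕ → ℕ) {s t : ℕ} (n : ℕ) (σ : List Bool), s ≤ t → Q (pre O s) n σ →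
        Q (pre O t) n σ) ∧
      ∀ n σ, σ ∈ W n ↔ ∃ s, Q (pre (chi A) s) n σ := by
  obtain ⟨c, hc⟩ := h
  obtain ⟨f, hf⟩ := c.exists_approx
  refine ⟨fun l n σ => (f l (Nat.pair n (Encodable.encode σ))).isSome, ?_, ?_, ?_⟩
  · exact Primrec.eq.comp (Primrec.option_isSome.comp (hf.primrec.comp Primrec.fst
      (Primrec₂.natPair.comp (Primrec.fst.comp Primrec.snd)
        (Primrec.encode.comp (Primrec.snd.comp Primrec.snd))))) (Primrec.const true)
  · intro O s t n σ hst h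
    obtain ⟨x, hx⟩ := Option.isSome_iff_exists.1 h
    exact Option.isSome_iff_exists.2 ⟨x, hf.mono O _ _ hst hx⟩
  · intro n σ
    rw [hc, Part.dom_iff_mem]
    simp only [hf.spec, Option.isSome_iff_exists]
    exact exists_comm

theorem ceSeqIn_of_stage {A : Set ℕ} {Q : List ℕ → ℕ → List Bool → Prop}
    (hQ : PrimrecPred (fun p : List ℕ × ℕ × List Bool => Q p.1 p.2.1 p.2.2)) :
    CeSeqIn A fun n => {σ | ∃ s, Q (pre (chi A) s) n σ} := by
  classical
  have hg : Primrec₂ fun (l : List ℕ) (n : ℕ) =>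
      ((Encodable.decode (α := List Bool) n.unpair.2).bind fun σ =>
        if Q l n.unpair.1 σ then some 0 else none : Option ℕ) := by
    refine Primrec.option_bind
      (Primrec.decode.comp (Primrec.snd.comp (Primrec.unpair.comp Primrec.snd)))
      (Primrec.ite ?_ (Primrec.const _) (Primrec.const _))
    exact hQ.comp (Primrec.pair (Primrec.fst.comp Primrec.fst)
      (Primrec.pair (Primrec.fst.comp (Primrec.unpair.comp (Primrec.snd.comp Primrec.fst)))
        Primrec.snd))
  obtain ⟨c, hc⟩ := exists_code_rfindOpt hg
  refine ⟨c, fun n σ => ?_⟩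
  rw [hc, Nat.rfindOpt_dom]
  simp

/-! ### Cylinders and sequences -/

theorem pre_eq_iff (X : ℕ → Bool) (σ : List Bool) :
    (∀ i : Fin σ.length, X i = σ.get i) ↔ pre X σ.length = σ := by
  constructor
  · intro h
    refine List.ext_getElem (by simp) fun i h1 h2 => ?_
    simpa [pre] using h ⟨i, h2⟩
  · intro h i
    have := getElem?_pre X i.2
    rw [h, List.getElem?_eq_getElem i.2] at this
    simpa using this.symm

theorem mem_Cyl {W : Set (List Bool)} {X : ℕ → Bool} : X ∈ Cyl W ↔ ∃ n, pre X n ∈ W := by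
  constructor
  · rintro ⟨σ, hσ, h⟩
    exact ⟨σ.length, by rwa [(pre_eq_iff X σ).1 h]⟩
  · rintro ⟨n, h⟩
    exact ⟨_, h, (pre_eq_iff X _).2 (by simp)⟩

theorem Cyl_mono {V W : Set (List Bool)} (h : V ⊆ W) : Cyl V ⊆ Cyl W :=
  fun _ ⟨σ, hσ, hX⟩ => ⟨σ, h hσ, hX⟩

/-- The set of sequences extending `σ`. -/
def cone (σ : List Bool) : Set (ℕ → Bool) := {X | pre X σ.length = σ}

theorem mem_cone {σ : List Bool} {X : ℕ → Bool} : X ∈ cone σ ↔ pre X σ.length = σ := Iff.rfl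

theorem Cyl_eq_iUnion (W : Set (List Bool)) : Cyl W = ⋃ σ ∈ W, cone σ := by
  ext X
  simp only [Cyl, pre_eq_iff, Set.mem_iUnion, cone, exists_prop]
  rfl

/-! ### Measure of cylinders -/

/-- The number with binary expansion `σ`, most significant bit first. -/
def val (σ : List Bool) : ℕ := σ.foldl (fun a b => 2 * a + b.toNat) 0

theorem val_concat (σ : List Bool) (b : Bool) : val (σ ++ [b]) = 2 * val σ + b.toNat := by
  simp [val]

@[simp] theorem val_nil : val [] = 0 := rfl

theorem val_lt (σ : List Bool) : val σ < 2 ^ σ.length := by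
  induction σ using List.reverseRecOn with
  | nil => simp
  | append_singleton σ b ih =>
    rw [val_concat, List.length_append, List.length_singleton, pow_succ]
    have := Bool.toNat_lt b
    omega

theorem val_injective {σ τ : List Bool} (hl : σ.length = τ.length) (h : val σ = val τ) :
    σ = τ := by
  induction σ using List.reverseRecOn generalizing τ with
  | nil => exact (List.length_eq_zero_iff.1 hl.symm).symm
  | append_singleton σ b ih =>
    rcases List.eq_nil_or_concat τ with rfl | ⟨τ, c, rfl⟩
    · simp at hl
    · rw [List.concat_eq_append] at hl h ⊢
      rw [val_concat, val_concat] at h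
      have hb := Bool.toNat_lt b
      have hc := Bool.toNat_lt c
      rw [ih (by simpa using hl) (by omega), show b = c by cases b <;> cases c <;> simp at h ⊢ <;> omega]

theorem exists_val_eq {n k : ℕ} (h : k < 2 ^ n) : ∃ σ : List Bool, σ.length = n ∧ val σ = k := by
  induction n generalizing k with
  | zero => exact ⟨[], rfl, by simp at h; simp [h]⟩
  | succ n ih =>
    obtain ⟨σ, hl, hv⟩ := ih (k := k / 2) (by rw [pow_succ] at h; omega)
    refine ⟨σ ++ [decide (k % 2 = 1)], by simp [hl], ?_⟩
    rw [val_concat, hv]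
    rcases Nat.mod_two_eq_zero_or_one k with h | h <;> simp [h] <;> omega

theorem val_append (σ ρ : List Bool) : val (σ ++ ρ) = 2 ^ ρ.length * val σ + val ρ := by
  induction ρ using List.reverseRecOn with
  | nil => simp
  | append_singleton ρ b ih =>
    rw [← List.append_assoc, val_concat, ih, val_concat, List.length_append,
      List.length_singleton, pow_succ]
    ring

/-- The binary expansion of a real number. -/
noncomputable def expand (x : ℝ) : ℕ → Bool := fun n => decide (⌊x * 2 ^ (n + 1)⌋₊ % 2 = 1)

theorem val_pre_expand {x : ℝ} (h1 : x < 1) (n : ℕ) :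
    val (pre (expand x) n) = ⌊x * 2 ^ n⌋₊ := by
  induction n with
  | zero =>
    symm
    simpa [pre] using h1
  | succ n ih =>
    rw [pre_succ, val_concat, ih]
    have hdiv : ⌊x * 2 ^ (n + 1)⌋₊ / 2 = ⌊x * 2 ^ n⌋₊ := by
      rw [← Nat.floor_div_natCast]
      congr 1
      rw [pow_succ]
      push_cast
      ring
    have := Nat.mod_add_div ⌊x * 2 ^ (n + 1)⌋₊ 2
    rw [hdiv] at this
    simp only [expand]
    rcases Nat.mod_two_eq_zero_or_one ⌊x * 2 ^ (n + 1)⌋₊ with h | h <;> simp [h] <;> omega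

theorem measurable_expand : Measurable expand := by
  refine measurable_pi_lambda _ fun n => ?_
  have : Measurable fun k : ℕ => decide (k % 2 = 1) := measurable_from_top
  exact this.comp (Nat.measurable_floor.comp (measurable_id.mul_const _))

theorem measurableSet_pre (p : List Bool → Prop) (n : ℕ) :
    MeasurableSet {X : ℕ → Bool | p (pre X n)} := by
  have : Measurable fun X : ℕ → Bool => fun i : Fin n => X i :=
    measurable_pi_lambda _ fun i => measurable_pi_apply _
  have h : {X : ℕ → Bool | p (pre X n)} =
      (fun X : ℕ → Bool => fun i : Fin n => X i) ⁻¹' {v | p (List.ofFn v)} := by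
    ext X
    simp only [Set.mem_ofPred_eq, Set.mem_preimage]
    rw [show pre X n = List.ofFn fun i : Fin n => X i by
      refine List.ext_getElem (by simp) fun i h1 h2 => by simp [pre]]
  rw [h]
  exact this (Set.toFinite _).measurableSet

theorem measurableSet_cone (σ : List Bool) : MeasurableSet (cone σ) :=
  measurableSet_pre (· = σ) _

theorem measurableSet_Cyl (W : Set (List Bool)) : MeasurableSet (Cyl W) := by
  rw [Cyl_eq_iUnion]
  exact MeasurableSet.biUnion (Set.to_countable _) fun σ _ => measurableSet_cone σ

instance : IsProbabilityMeasure mu := by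
  constructor
  change (volume.restrict (Set.Ico (0 : ℝ) 1)).map expand Set.univ = 1
  rw [Measure.map_apply measurable_expand MeasurableSet.univ]
  simp

theorem mu_cone (σ : List Bool) :
    mu (cone σ) = (2⁻¹ : ENNReal) ^ σ.length := by
  change (volume.restrict (Set.Ico (0 : ℝ) 1)).map expand _ = _
  rw [Measure.map_apply measurable_expand (measurableSet_cone _),
    Measure.restrict_apply (measurable_expand (measurableSet_cone _))]
  set n := σ.length with hn
  have hpos : (0 : ℝ) < 2 ^ n := by positivity
  have : expand ⁻¹' cone σ ∩ Set.Ico 0 1 =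
      Set.Ico ((val σ : ℝ) / 2 ^ n) ((val σ + 1) / 2 ^ n) := by
    ext x
    have key : 0 ≤ x → x < 1 → (pre (expand x) n = σ ↔
        (val σ : ℝ) / 2 ^ n ≤ x ∧ x < (val σ + 1) / 2 ^ n) := by
      intro h0 h1
      rw [div_le_iff₀ hpos, lt_div_iff₀ hpos, ← Nat.floor_eq_iff (by positivity),
        ← val_pre_expand h1]
      exact ⟨fun h => by rw [h], fun h => val_injective (by simp [hn]) h⟩
    simp only [Set.mem_inter_iff, Set.mem_preimage, mem_cone, Set.mem_Ico, ← hn]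
    constructor
    · rintro ⟨h, h0, h1⟩
      exact (key h0 h1).1 h
    · intro h
      have h0 : 0 ≤ x := le_trans (by positivity) h.1
      have h1 : x < 1 := by
        refine h.2.trans_le ?_
        rw [div_le_one hpos]
        exact_mod_cast val_lt σ
      exact ⟨(key h0 h1).2 h, h0, h1⟩
  rw [this, Real.volume_Ico]
  have : ((val σ + 1) / 2 ^ n - val σ / 2 ^ n : ℝ) = (2⁻¹) ^ n := by
    field_simp
    simp [inv_pow]
  rw [this, ENNReal.ofReal_pow (by norm_num), ENNReal.ofReal_inv_of_pos (by norm_num)]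
  simp

/-- The weight `2 ^ (-|σ|)` of a string. -/
noncomputable def wt (σ : List Bool) : ENNReal := 2⁻¹ ^ σ.length

theorem mu_Cyl_le (W : Set (List Bool)) : mu (Cyl W) ≤ ∑' σ : W, wt σ := by
  rw [Cyl_eq_iUnion]
  refine (measure_biUnion_le _ (Set.to_countable W) _).trans_eq ?_
  exact tsum_congr fun σ => mu_cone σ

/-- No string in `W` properly extends another one. -/
def IsAntichainStr (W : Set (List Bool)) : Prop :=
  ∀ σ ∈ W, ∀ τ ∈ W, σ <+: τ → σ = τ

theorem mu_Cyl_eq {W : Set (List Bool)} (hW : IsAntichainStr W) :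
    mu (Cyl W) = ∑' σ : W, wt σ := by
  rw [Cyl_eq_iUnion, measure_biUnion (Set.to_countable W) ?_ fun σ _ => measurableSet_cone σ]
  · exact tsum_congr fun σ => mu_cone σ
  · intro σ hσ τ hτ hne
    refine Set.disjoint_left.2 fun X h1 h2 => hne ?_
    rw [mem_cone] at h1 h2
    rcases le_total σ.length τ.length with h | h
    · refine hW σ hσ τ hτ ?_
      rw [← h1, ← h2, ← take_pre X h]
      exact ⟨_, List.take_append_drop _ _⟩
    · refine (hW τ hτ σ hσ ?_).symm
      rw [← h1, ← h2, ← take_pre X h]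
      exact ⟨_, List.take_append_drop _ _⟩

theorem tsum_wt_le_one {W : Set (List Bool)} (hW : IsAntichainStr W) : ∑' σ : W, wt σ ≤ 1 := by
  rw [← mu_Cyl_eq hW]
  exact prob_le_one

/-! ### Independence of blocks of coordinates -/

/-- The uniform measure on `Bool`. -/
noncomputable def coin : Measure Bool :=
  (2⁻¹ : ENNReal) • Measure.dirac true + (2⁻¹ : ENNReal) • Measure.dirac false

theorem coin_singleton (b : Bool) : coin {b} = 2⁻¹ := by
  cases b <;> simp [coin]

instance : IsProbabilityMeasure coin := by
  constructor
  simp [coin, ENNReal.inv_two_add_inv_two]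

theorem cone_eq_pi (σ : List Bool) :
    cone σ = Set.pi (Finset.range σ.length : Set ℕ) fun i => {σ.getD i true} := by
  ext X
  rw [mem_cone, ← pre_eq_iff]
  simp only [Finset.coe_range, Set.mem_pi, Set.mem_Iio, Set.mem_singleton_iff]
  constructor
  · intro h i hi
    simpa [hi] using h ⟨i, hi⟩
  · intro h i
    simpa using h i i.2

theorem isPiSystem_cone : IsPiSystem (Set.range cone) := by
  rintro _ ⟨σ, rfl⟩ _ ⟨τ, rfl⟩ ⟨X, h1, h2⟩
  rw [mem_cone] at h1 h2
  have key : ∀ {m n : ℕ}, m ≤ n → cone (pre X m) ∩ cone (pre X n) = cone (pre X n) := by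
    intro m n h
    refine Set.inter_eq_right.2 fun Y hY => ?_
    rw [mem_cone, length_pre] at hY ⊢
    rw [← take_pre Y h, hY, take_pre X h]
  rw [← h1, ← h2]
  rcases le_total σ.length τ.length with h | h
  · exact ⟨_, (key h).symm⟩
  · rw [Set.inter_comm]
    exact ⟨_, (key h).symm⟩

theorem generateFrom_cone :
    (MeasurableSpace.pi : MeasurableSpace (ℕ → Bool)) =
      MeasurableSpace.generateFrom (Set.range cone) := by
  apply le_antisymm
  · refine iSup_le fun i => ?_
    rintro _ ⟨s, -, rfl⟩
    have : (fun X : ℕ → Bool => X i) ⁻¹' s =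
        ⋃ σ ∈ {σ : List Bool | σ.length = i + 1 ∧ ∃ b ∈ s, σ[i]? = some b}, cone σ := by
      ext X
      simp only [Set.mem_preimage, Set.mem_iUnion, Set.mem_ofPred_eq, exists_prop, mem_cone]
      constructor
      · intro h
        exact ⟨pre X (i + 1), ⟨by simp, X i, h, getElem?_pre X (by simp)⟩, by simp⟩
      · rintro ⟨σ, ⟨hl, b, hb, hσ⟩, h⟩
        rw [← h, hl, getElem?_pre X (Nat.lt_succ_self i), Option.some_inj] at hσ
        rwa [hσ]
    rw [this]
    exact MeasurableSet.biUnion (Set.to_countable _) fun σ _ =>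
      MeasurableSpace.measurableSet_generateFrom ⟨σ, rfl⟩
  · refine MeasurableSpace.generateFrom_le ?_
    rintro _ ⟨σ, rfl⟩
    exact measurableSet_cone σ

theorem mu_eq_infinitePi : mu = Measure.infinitePi fun _ : ℕ => coin := by
  refine ext_of_generate_finite _ generateFrom_cone isPiSystem_cone ?_ (by simp)
  rintro _ ⟨σ, rfl⟩
  rw [mu_cone, cone_eq_pi, Measure.infinitePi_pi _ fun _ _ => MeasurableSet.singleton _]
  simp [coin_singleton]

/-- The set of sequences whose `i`-th column starts with `n` ones. -/
def block (i n : ℕ) : Set (ℕ → Bool) := {X | ∀ j < n, X (Nat.pair i j) = true}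

theorem mu_biInter_compl_block (m : ℕ → ℕ) (F : Finset ℕ) :
    mu (⋂ i ∈ F, (block i (m i))ᶜ) = ∏ i ∈ F, (1 - (2⁻¹ : ENNReal) ^ m i) := by
  set ν : Measure (ℕ → Bool) := Measure.infinitePi fun _ : ℕ => coin with hν
  set D : ℕ → Set (ℕ → Bool) := fun n => Set.pi (Finset.range n : Set ℕ) fun _ => {true} with hD
  have hDm : ∀ n, MeasurableSet (D n) := fun n =>
    MeasurableSet.pi (Set.to_countable _) fun _ _ => MeasurableSet.singleton _
  have hD' : ∀ n, ν (D n)ᶜ = 1 - 2⁻¹ ^ n := by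
    intro n
    rw [prob_compl_eq_one_sub (hDm n), hD, hν,
      Measure.infinitePi_pi _ fun _ _ => MeasurableSet.singleton _]
    simp [coin_singleton]
  have hmap : mu.map (fun X (i j : ℕ) => X (Nat.pair i j)) =
      Measure.infinitePi fun _ : ℕ => ν := by
    rw [hν, ← Measure.infinitePi_map_curry (fun _ _ : ℕ => coin)]
    have hinj : Function.Injective fun p : ℕ × ℕ => Nat.pair p.1 p.2 := fun p q h => by
      have := Nat.pair_eq_pair.1 h
      exact Prod.ext this.1 this.2
    rw [← Measure.map_infinitePi_infinitePi_of_inj (P := fun _ : ℕ => coin) hinj,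
      Measure.map_map (by fun_prop) (by fun_prop), mu_eq_infinitePi]
    rfl
  have hpre : (⋂ i ∈ F, (block i (m i))ᶜ) =
      (fun (X : ℕ → Bool) (i j : ℕ) => X (Nat.pair i j)) ⁻¹'
        Set.pi (F : Set ℕ) fun i => (D (m i))ᶜ := by
    ext X
    simp [block, hD]
  rw [hpre, ← Measure.map_apply (by fun_prop)
    (MeasurableSet.pi (Set.to_countable _) fun i _ => (hDm _).compl), hmap,
    Measure.infinitePi_pi _ fun i _ => (hDm _).compl]
  exact Finset.prod_congr rfl fun i _ => hD' _

theorem exists_bound_of_disjoint_block {B : Set (ℕ → Bool)} (hB : mu B ≠ 0) (m : ℕ → ℕ)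
    {I : Set ℕ} (hI : ∀ i ∈ I, Disjoint B (block i (m i))) :
    ∃ c : ℕ, ∀ F : Finset ℕ, ↑F ⊆ I → ∑ i ∈ F, (2⁻¹ : ENNReal) ^ m i ≤ 2 ^ c := by
  have hδ : 0 < mu.real B := ENNReal.toReal_pos hB (measure_ne_top _ _)
  obtain ⟨c, hc⟩ := pow_unbounded_of_one_lt (-Real.log (mu.real B)) (one_lt_two (α := ℝ))
  refine ⟨c, fun F hF => ?_⟩
  have h1 : mu B ≤ ENNReal.ofReal (Real.exp (-∑ i ∈ F, (2⁻¹ : ℝ) ^ m i)) := by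
    calc mu B ≤ mu (⋂ i ∈ F, (block i (m i))ᶜ) := measure_mono <|
          Set.subset_iInter₂ fun i hi => (hI i (hF hi)).subset_compl_right
      _ = ∏ i ∈ F, (1 - (2⁻¹ : ENNReal) ^ m i) := mu_biInter_compl_block m F
      _ ≤ ∏ i ∈ F, ENNReal.ofReal (Real.exp (-(2⁻¹ : ℝ) ^ m i)) := by
        refine Finset.prod_le_prod' fun i _ => ?_
        have : (2⁻¹ : ENNReal) ^ m i = ENNReal.ofReal ((2⁻¹ : ℝ) ^ m i) := by
          rw [ENNReal.ofReal_pow (by norm_num), ENNReal.ofReal_inv_of_pos (by norm_num)]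
          simp
        rw [this, ← ENNReal.ofReal_one, ← ENNReal.ofReal_sub _ (by positivity)]
        exact ENNReal.ofReal_le_ofReal (by linarith [Real.add_one_le_exp (-(2⁻¹ : ℝ) ^ m i)])
      _ = _ := by
        rw [← ENNReal.ofReal_prod_of_nonneg fun _ _ => (Real.exp_pos _).le, ← Real.exp_sum,
          Finset.sum_neg_distrib]
  have h2 : mu.real B ≤ Real.exp (-∑ i ∈ F, (2⁻¹ : ℝ) ^ m i) :=
    ENNReal.toReal_le_of_le_ofReal (Real.exp_pos _).le h1
  have h3 : ∑ i ∈ F, (2⁻¹ : ℝ) ^ m i ≤ 2 ^ c := by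
    have := (Real.log_le_iff_le_exp hδ).2 h2
    linarith
  have h4 := ENNReal.ofReal_le_ofReal h3
  rw [ENNReal.ofReal_sum_of_nonneg fun _ _ => by positivity] at h4
  simpa [ENNReal.ofReal_pow, ENNReal.ofReal_inv_of_pos, ENNReal.inv_pow] using h4

/-! ### Machines from request sequences -/

theorem primrec_pow : Primrec₂ ((· ^ ·) : ℕ → ℕ → ℕ) :=
  Primrec₂.unpaired'.1 Nat.Primrec.pow

theorem primrec_val : Primrec val := by
  have hstep : Primrec₂ fun (_ : List Bool) (p : ℕ × Bool) => 2 * p.1 + p.2.toNat :=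
    Primrec.nat_add.comp
      (Primrec.nat_mul.comp (Primrec.const 2) (Primrec.fst.comp Primrec.snd))
      ((Primrec.dom_bool Bool.toNat).comp (Primrec.snd.comp Primrec.snd))
  exact Primrec.list_foldl Primrec.id (Primrec.const 0) hstep

/-- The weight `2 ^ (-n)` of a request `(n, τ)`. -/
noncomputable def reqWt (o : Option (ℕ × List Bool)) : ℝ≥0 := o.elim 0 fun p => 2⁻¹ ^ p.1

/-- The total weight `P / 2 ^ D` of the requests before stage `t`, stored as `(P, D)`. -/
def reqPos (R : List ℕ → Option (ℕ × List Bool)) (l : List ℕ) : ℕ → ℕ × ℕ :=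
  Nat.rec (0, 0) fun t q =>
    ((R (l.take t)).map fun p => (q.1 * 2 ^ p.1 + 2 ^ q.2, q.2 + p.1)).getD q

/-- The index of the dyadic interval of length `2 ^ (-(n + 1))` allotted to a request of
length `n` when `P / 2 ^ D` has been used up. -/
def slot (q : ℕ × ℕ) (n : ℕ) : ℕ := (q.1 * 2 ^ (n + 1) + (2 ^ q.2 - 1)) / 2 ^ q.2

theorem slot_bounds (q : ℕ × ℕ) (n : ℕ) :
    (q.1 : ℝ) / 2 ^ q.2 ≤ (slot q n : ℝ) / 2 ^ (n + 1) ∧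
      ((slot q n : ℝ) + 1) / 2 ^ (n + 1) ≤ (q.1 : ℝ) / 2 ^ q.2 + 2⁻¹ ^ n := by
  obtain ⟨P, D⟩ := q
  have hD : 0 < 2 ^ D := by positivity
  have hmod := Nat.mod_lt (P * 2 ^ (n + 1) + (2 ^ D - 1)) hD
  have hdiv := Nat.div_add_mod (P * 2 ^ (n + 1) + (2 ^ D - 1)) (2 ^ D)
  simp only [slot]
  set k := (P * 2 ^ (n + 1) + (2 ^ D - 1)) / 2 ^ D
  have h1 : P * 2 ^ (n + 1) ≤ 2 ^ D * k := by omega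
  have h2 : 2 ^ D * k + 1 ≤ P * 2 ^ (n + 1) + 2 ^ D := by omega
  have h1' : (P : ℝ) * 2 ^ (n + 1) ≤ 2 ^ D * k := by exact_mod_cast h1
  have h2' : (2 : ℝ) ^ D * k + 1 ≤ P * 2 ^ (n + 1) + 2 ^ D := by exact_mod_cast h2
  have hD' : (0 : ℝ) < 2 ^ D := by positivity
  have hn' : (0 : ℝ) < 2 ^ (n + 1) := by positivity
  constructor
  · rw [div_le_div_iff₀ hD' hn']
    linarith
  · have : (P : ℝ) / 2 ^ D + 2⁻¹ ^ n = (P * 2 ^ (n + 1) + 2 * 2 ^ D) / (2 ^ D * 2 ^ (n + 1)) := by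
      rw [inv_pow]
      field_simp
      ring
    rw [this, div_le_div_iff₀ hn' (by positivity)]
    nlinarith

theorem reqPos_eq (R : List ℕ → Option (ℕ × List Bool)) (O : ℕ → ℕ) {s t : ℕ} (h : t ≤ s) :
    ((reqPos R (pre O s) t).1 : ℝ) / 2 ^ (reqPos R (pre O s) t).2 =
      ∑ i ∈ Finset.range t, (reqWt (R (pre O i)) : ℝ) := by
  induction t with
  | zero => simp [reqPos]
  | succ t ih =>
    have ih := ih (by omega)
    rw [Finset.sum_range_succ, ← ih, show reqPos R (pre O s) (t + 1) =
      ((R ((pre O s).take t)).map fun p => ((reqPos R (pre O s) t).1 * 2 ^ p.1 +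
        2 ^ (reqPos R (pre O s) t).2, (reqPos R (pre O s) t).2 + p.1)).getD
          (reqPos R (pre O s) t) from rfl, take_pre O (by omega)]
    rcases R (pre O t) with _ | ⟨n, τ⟩
    · simp [reqWt]
    · simp only [Option.map_some, Option.getD_some, reqWt, Option.elim_some]
      push_cast
      rw [pow_add, inv_pow]
      field_simp

theorem primrec_reqPos {R : List ℕ → Option (ℕ × List Bool)} (hR : Primrec R) :
    Primrec₂ (reqPos R) := by
  have hstep : Primrec₂ fun (a : List ℕ × ℕ) (q : ℕ × ℕ × ℕ) =>
      ((R (a.1.take q.1)).map fun p => (q.2.1 * 2 ^ p.1 + 2 ^ q.2.2, q.2.2 + p.1)).getD q.2 := by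
    have hq : Primrec fun x : ((List ℕ × ℕ) × ℕ × ℕ × ℕ) × ℕ × List Bool => x.1.2.2 :=
      Primrec.snd.comp (Primrec.snd.comp Primrec.fst)
    have hp : Primrec fun x : ((List ℕ × ℕ) × ℕ × ℕ × ℕ) × ℕ × List Bool => x.2.1 :=
      Primrec.fst.comp Primrec.snd
    refine Primrec.option_getD.comp (Primrec.option_map (hR.comp (Primrec.list_take.comp
      (Primrec.fst.comp Primrec.snd) (Primrec.fst.comp Primrec.fst))) ?_)
      (Primrec.snd.comp Primrec.snd)
    exact Primrec.pair (Primrec.nat_add.comp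
      (Primrec.nat_mul.comp (Primrec.fst.comp hq) (primrec_pow.comp (Primrec.const 2) hp))
      (primrec_pow.comp (Primrec.const 2) (Primrec.snd.comp hq)))
      (Primrec.nat_add.comp (Primrec.snd.comp hq) hp)
  exact Primrec.nat_rec' (h := fun (a : List ℕ × ℕ) q =>
    ((R (a.1.take q.1)).map fun p => (q.2.1 * 2 ^ p.1 + 2 ^ q.2.2, q.2.2 + p.1)).getD q.2)
    Primrec.snd (Primrec.const (0, 0)) hstep

/-- The machine that answers the request made at stage `l` on the string naming its slot. -/
def reqMachine (R : List ℕ → Option (ℕ × List Bool)) (l : List ℕ) (σ : List Bool) :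
    Option (List Bool) :=
  (R l).bind fun p =>
    if σ.length = p.1 + 1 ∧ val σ = slot (reqPos R l l.length) p.1 then some p.2 else none

theorem primrec_reqMachine {R : List ℕ → Option (ℕ × List Bool)} (hR : Primrec R) :
    Primrec₂ (reqMachine R) := by
  refine Primrec.option_bind (hR.comp Primrec.fst) (Primrec.ite ?_
    (Primrec.option_some.comp (Primrec.snd.comp Primrec.snd)) (Primrec.const none))
  have hσ : Primrec fun x : (List ℕ × List Bool) × ℕ × List Bool => x.1.2 :=
    Primrec.snd.comp Primrec.fst
  have hn : Primrec fun x : (List ℕ × List Bool) × ℕ × List Bool => x.2.1 :=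
    Primrec.fst.comp Primrec.snd
  have hl : Primrec fun x : (List ℕ × List Bool) × ℕ × List Bool => x.1.1 :=
    Primrec.fst.comp Primrec.fst
  have hq : Primrec fun x : (List ℕ × List Bool) × ℕ × List Bool =>
      reqPos R x.1.1 x.1.1.length := (primrec_reqPos hR).comp hl (Primrec.list_length.comp hl)
  have hpow : Primrec fun x : (List ℕ × List Bool) × ℕ × List Bool =>
      2 ^ (reqPos R x.1.1 x.1.1.length).2 :=
    primrec_pow.comp (Primrec.const 2) (Primrec.snd.comp hq)
  refine (Primrec.eq.comp (Primrec.list_length.comp hσ) (Primrec.succ.comp hn)).and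
    (Primrec.eq.comp (primrec_val.comp hσ) (Primrec.nat_div.comp (Primrec.nat_add.comp
      (Primrec.nat_mul.comp (Primrec.fst.comp hq)
        (primrec_pow.comp (Primrec.const 2) (Primrec.succ.comp hn)))
      (Primrec.nat_sub.comp hpow (Primrec.const 1))) hpow))

theorem reqMachine_eq_some {R : List ℕ → Option (ℕ × List Bool)} {l : List ℕ} {σ τ : List Bool} :
    reqMachine R l σ = some τ ↔ ∃ n, R l = some (n, τ) ∧ σ.length = n + 1 ∧
      val σ = slot (reqPos R l l.length) n := by
  simp only [reqMachine, Option.bind_eq_some_iff, Option.ite_none_right_eq_some,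
    Option.some.injEq, Prod.exists]
  constructor
  · rintro ⟨n, _, h, h', rfl⟩
    exact ⟨n, h, h'⟩
  · rintro ⟨n, h, h'⟩
    exact ⟨n, τ, h, h', rfl⟩

theorem reqMachine_bounds {R : List ℕ → Option (ℕ × List Bool)} {O : ℕ → ℕ} {t : ℕ}
    {σ τ : List Bool} (h : reqMachine R (pre O t) σ = some τ) :
    (∑ i ∈ Finset.range t, (reqWt (R (pre O i)) : ℝ)) ≤ val σ / 2 ^ σ.length ∧
      ((val σ : ℝ) + 1) / 2 ^ σ.length ≤
        ∑ i ∈ Finset.range (t + 1), (reqWt (R (pre O i)) : ℝ) := by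
  obtain ⟨n, h, hl, hv⟩ := reqMachine_eq_some.1 h
  have := slot_bounds (reqPos R (pre O t) (pre O t).length) n
  rw [← hv, ← hl, length_pre, reqPos_eq R O le_rfl] at this
  rw [Finset.sum_range_succ]
  refine ⟨this.1, this.2.trans_eq ?_⟩
  rw [h]
  simp [reqWt]

theorem val_div_of_append {σ τ : List Bool} (h : σ <+: τ) :
    (val σ : ℝ) / 2 ^ σ.length ≤ val τ / 2 ^ τ.length ∧
      (val τ : ℝ) / 2 ^ τ.length < (val σ + 1) / 2 ^ σ.length := by
  obtain ⟨ρ, rfl⟩ := h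
  have h1 : (val ρ : ℝ) < 2 ^ ρ.length := by exact_mod_cast val_lt ρ
  have h0 : (0 : ℝ) ≤ val ρ := by positivity
  have hs : (0 : ℝ) < 2 ^ σ.length := by positivity
  have hr : (0 : ℝ) < 2 ^ ρ.length := by positivity
  rw [val_append, List.length_append, pow_add]
  push_cast
  constructor
  · rw [div_le_div_iff₀ hs (by positivity)]
    nlinarith
  · rw [div_lt_div_iff₀ (by positivity) hs]
    nlinarith

theorem reqMachine_stage_unique {R : List ℕ → Option (ℕ × List Bool)} {O : ℕ → ℕ} {s t : ℕ}
    {σ₁ σ₂ τ₁ τ₂ : List Bool} (hp : σ₁ <+: σ₂) (h₁ : reqMachine R (pre O s) σ₁ = some τ₁)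
    (h₂ : reqMachine R (pre O t) σ₂ = some τ₂) : s = t := by
  have hmono : Monotone fun t => ∑ i ∈ Finset.range t, (reqWt (R (pre O i)) : ℝ) :=
    monotone_nat_of_le_succ fun t => by
      rw [Finset.sum_range_succ]
      exact le_add_of_nonneg_right (NNReal.coe_nonneg _)
  have b₁ := reqMachine_bounds h₁
  have b₂ := reqMachine_bounds h₂
  have hv := val_div_of_append hp
  have hlt : (val σ₂ : ℝ) / 2 ^ σ₂.length < (val σ₂ + 1) / 2 ^ σ₂.length := by
    gcongr
    linarith
  rcases lt_trichotomy s t with h | h | h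
  · have := hmono (show s + 1 ≤ t from h)
    simp only at this
    linarith [b₁.2, b₂.1, hv.2]
  · exact h
  · have := hmono (show t + 1 ≤ s from h)
    simp only at this
    linarith [b₁.1, b₂.2, hv.1]

theorem mem_rfindOpt_reqMachine {R : List ℕ → Option (ℕ × List Bool)} {O : ℕ → ℕ}
    {σ τ : List Bool} :
    (τ ∈ Nat.rfindOpt fun s => reqMachine R (pre O s) σ) ↔
      ∃ t, reqMachine R (pre O t) σ = some τ := by
  constructor
  · intro h
    exact Nat.rfindOpt_spec h
  · rintro ⟨t, ht⟩
    have hd : (Nat.rfindOpt fun s => reqMachine R (pre O s) σ).Dom :=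
      Nat.rfindOpt_dom.2 ⟨t, τ, ht⟩
    obtain ⟨τ', hτ'⟩ := Part.dom_iff_mem.1 hd
    obtain ⟨s, hs⟩ := Nat.rfindOpt_spec hτ'
    obtain rfl := reqMachine_stage_unique (List.prefix_refl σ) hs ht
    rw [Option.mem_def, ht, Option.some_inj] at hs
    rwa [hs]

/-- The Kraft–Chaitin theorem, uniformly in the oracle. -/
theorem exists_machine_of_requests {R : List ℕ → Option (ℕ × List Bool)} (hR : Primrec R) :
    ∃ c, PrefixFreeMachine c ∧ ∀ O : ℕ → ℕ, ∑' t, (reqWt (R (pre O t)) : ℝ≥0∞) ≤ 1 →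
      ∀ t n τ, R (pre O t) = some (n, τ) → ∃ σ, σ.length = n + 1 ∧ τ ∈ evalStr c O σ := by
  obtain ⟨c, hc⟩ := exists_machine (primrec_reqMachine hR)
  refine ⟨c, ?_, ?_⟩
  · intro O σ₁ σ₂ hp h₁ h₂
    obtain ⟨τ₁, h₁⟩ := Part.dom_iff_mem.1 h₁
    obtain ⟨τ₂, h₂⟩ := Part.dom_iff_mem.1 h₂
    rw [hc, mem_rfindOpt_reqMachine] at h₁ h₂
    obtain ⟨s, hs⟩ := h₁
    obtain ⟨t, ht⟩ := h₂
    obtain rfl := reqMachine_stage_unique hp hs ht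
    obtain ⟨n, hn, hl, -⟩ := reqMachine_eq_some.1 hs
    obtain ⟨n', hn', hl', -⟩ := reqMachine_eq_some.1 ht
    rw [hn, Option.some_inj, Prod.mk.injEq] at hn'
    exact hp.eq_of_length (by omega)
  · intro O hO t n τ h
    have hw : ∑ i ∈ Finset.range (t + 1), (reqWt (R (pre O i)) : ℝ) ≤ 1 := by
      have := (ENNReal.sum_le_tsum (Finset.range (t + 1))).trans hO
      exact_mod_cast this
    set k := slot (reqPos R (pre O t) (pre O t).length) n with hk
    have hkn : k < 2 ^ (n + 1) := by
      have := (slot_bounds (reqPos R (pre O t) (pre O t).length) n).2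
      rw [← hk, length_pre, reqPos_eq R O le_rfl] at this
      rw [Finset.sum_range_succ, h] at hw
      simp only [reqWt, Option.elim_some, NNReal.coe_pow, NNReal.coe_inv, NNReal.coe_ofNat] at hw
      have h1 := this.trans hw
      rw [div_le_one (by positivity)] at h1
      have h2 : k + 1 ≤ 2 ^ (n + 1) := by exact_mod_cast h1
      omega
    obtain ⟨σ, hl, hv⟩ := exists_val_eq hkn
    refine ⟨σ, hl, ?_⟩
    rw [hc, mem_rfindOpt_reqMachine]
    exact ⟨t, reqMachine_eq_some.2 ⟨n, h, hl, hv⟩⟩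

theorem K_le_of_mem {u : OracleCode} {O : ℕ → ℕ} {σ τ : List Bool} (h : τ ∈ evalStr u O σ) :
    K u O τ ≤ σ.length :=
  iInf₂_le σ h

theorem UniversalPFM.exists_K_le {u : OracleCode} (hu : UniversalPFM u)
    {R : List ℕ → Option (ℕ × List Bool)} (hR : Primrec R) :
    ∃ d : ℕ, ∀ O : ℕ → ℕ, ∑' t, (reqWt (R (pre O t)) : ℝ≥0∞) ≤ 1 →
      ∀ t n τ, R (pre O t) = some (n, τ) → K u O τ ≤ (n + d : ℕ) := by
  obtain ⟨c, hc, h⟩ := exists_machine_of_requests hR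
  obtain ⟨d, hd⟩ := hu.2 c hc
  refine ⟨d + 1, fun O hO t n τ ht => ?_⟩
  obtain ⟨σ, hσ, hτ⟩ := h O hO t n τ ht
  obtain ⟨σ', hσ', hl⟩ := hd O σ τ hτ
  exact (K_le_of_mem hσ').trans (by exact_mod_cast (by omega : σ'.length ≤ n + (d + 1)))

theorem inv_two_pow_anti {m n : ℕ} (h : m ≤ n) : (2⁻¹ : ℝ≥0∞) ^ n ≤ 2⁻¹ ^ m :=
  pow_le_pow_right_of_le_one' (ENNReal.inv_le_one.2 one_le_two) h

theorem le_of_inv_two_pow_le {m n : ℕ} (h : (2⁻¹ : ℝ≥0∞) ^ n ≤ 2⁻¹ ^ m) : m ≤ n := by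
  rw [← ENNReal.inv_pow, ← ENNReal.inv_pow, ENNReal.inv_le_inv] at h
  have h' : 2 ^ m ≤ 2 ^ n := by exact_mod_cast h
  exact (Nat.pow_le_pow_iff_right one_lt_two).1 h'

theorem tsum_le_tsum_of_section {α β : Type*} {a : α → ℝ≥0∞} {g : β → ℝ≥0∞} (r : α → β → Prop)
    (hr : ∀ x x' y, r x y → r x' y → x = x') (h : ∀ x, a x ≠ 0 → ∃ y, r x y ∧ a x ≤ g y) :
    ∑' x, a x ≤ ∑' y, g y := by
  choose i hi using fun x : Function.support a => h x x.2
  have hinj : Function.Injective i := fun x x' hx =>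
    Subtype.ext (hr _ _ _ (hi x).1 (hx ▸ (hi x').1))
  rw [← tsum_subtype_support]
  calc ∑' x : Function.support a, a x ≤ ∑' x : Function.support a, g (i x) :=
        ENNReal.tsum_le_tsum fun x => (hi x).2
    _ ≤ ∑' y, g y := ENNReal.tsum_comp_le_tsum_of_injective hinj g

open Classical in
theorem UniversalPFM.exists_K_le_of_index {u : OracleCode} (hu : UniversalPFM u) {ι : Type*}
    [Primcodable ι] {P : List ℕ → ι → Prop} (hP : PrimrecRel P) {len : ι → ℕ}
    (hlen : Primrec len) {str : ι → List Bool} (hstr : Primrec str) :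
    ∃ d : ℕ, ∀ O : ℕ → ℕ,
      (∑' i, if P (pre O (Encodable.encode i)) i then (2⁻¹ : ℝ≥0∞) ^ len i else 0) ≤ 1 →
      ∀ i, P (pre O (Encodable.encode i)) i → K u O (str i) ≤ (len i + d : ℕ) := by
  set R : List ℕ → Option (ℕ × List Bool) := fun l =>
    (Encodable.decode (α := ι) l.length).bind fun i =>
      if Encodable.encode i = l.length ∧ P l i then some (len i, str i) else none with hR
  have hRp : Primrec R := by
    refine Primrec.option_bind (Primrec.decode.comp Primrec.list_length) (Primrec.ite ?_
      (Primrec.option_some.comp (Primrec.pair (hlen.comp Primrec.snd) (hstr.comp Primrec.snd)))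
      (Primrec.const none))
    exact (Primrec.eq.comp (Primrec.encode.comp Primrec.snd)
      (Primrec.list_length.comp Primrec.fst)).and (hP.comp Primrec.fst Primrec.snd)
  obtain ⟨d, hd⟩ := hu.exists_K_le hRp
  refine ⟨d, fun O hO i hi => ?_⟩
  refine hd O (le_trans ?_ hO) (Encodable.encode i) (len i) (str i) (by simp [hR, hi])
  refine tsum_le_tsum_of_section (fun t i => t = Encodable.encode i)
    (fun _ _ _ h h' => h.trans h'.symm) fun t ht => ?_
  cases h : R (pre O t) with
  | none => simp [h, reqWt] at ht
  | some p =>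
    simp only [hR, length_pre, Option.bind_eq_some_iff, Option.ite_none_right_eq_some] at h
    obtain ⟨i, -, ⟨rfl, hi⟩, hp⟩ := h
    refine ⟨i, rfl, ?_⟩
    rw [if_pos hi, ← Option.some_inj.1 hp]
    simp [reqWt, ENNReal.inv_pow]

/-! ### Complexity and strings -/

theorem exists_mem_of_K_le {u : OracleCode} {O : ℕ → ℕ} {τ : List Bool} {m : ℕ}
    (h : K u O τ ≤ m) : ∃ σ, τ ∈ evalStr u O σ ∧ σ.length ≤ m := by
  by_contra! hc
  have : ((m + 1 : ℕ) : ℕ∞) ≤ K u O τ :=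
    le_iInf₂ fun σ hσ => by exact_mod_cast hc σ hσ
  have := this.trans h
  norm_cast at this
  omega

/-- The list of all binary strings of length `n`. -/
def allStr : ℕ → List (List Bool) :=
  Nat.rec [[]] fun _ L => L.flatMap fun σ => [σ ++ [false], σ ++ [true]]

theorem mem_allStr {n : ℕ} {σ : List Bool} : σ ∈ allStr n ↔ σ.length = n := by
  induction n generalizing σ with
  | zero => simp [allStr]
  | succ n ih =>
    rw [show allStr (n + 1) = (allStr n).flatMap fun σ => [σ ++ [false], σ ++ [true]] from rfl]
    simp only [List.mem_flatMap, ih, List.mem_cons, List.not_mem_nil, or_false]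
    constructor
    · rintro ⟨τ, rfl, rfl | rfl⟩ <;> simp
    · intro h
      obtain ⟨τ, b, rfl⟩ := (List.eq_nil_or_concat' σ).resolve_left (by rintro rfl; simp at h)
      refine ⟨τ, by simpa using h, ?_⟩
      cases b <;> simp

theorem primrec_allStr : Primrec allStr := by
  refine Primrec.nat_rec₁ _ ?_
  have hσ : Primrec fun x : (ℕ × List (List Bool)) × List Bool => x.2 := Primrec.snd
  have h : ∀ b : Bool, Primrec fun x : (ℕ × List (List Bool)) × List Bool => x.2 ++ [b] :=
    fun b => Primrec.list_concat.comp hσ (Primrec.const b)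
  exact Primrec.list_flatMap Primrec.snd
    (Primrec.list_cons.comp (h false) (Primrec.list_cons.comp (h true) (Primrec.const [])))

/-- The strings that `u` compresses by at least `d` bits relative to `O`. -/
def compressible (u : OracleCode) (O : ℕ → ℕ) (d : ℕ) : Set (List Bool) :=
  {ρ | ∃ σ, ρ ∈ evalStr u O σ ∧ σ.length + d ≤ ρ.length}

theorem mem_compressible_of_K_le {u : OracleCode} {O : ℕ → ℕ} {d : ℕ} {ρ : List Bool}
    (h : K u O ρ + d ≤ ρ.length) : ρ ∈ compressible u O d := by
  have hne : K u O ρ ≠ ⊤ := by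
    intro h'
    rw [h', top_add, top_le_iff] at h
    exact ENat.natCast_ne_top _ h
  obtain ⟨k, hk⟩ := ENat.ne_top_iff_exists.1 hne
  obtain ⟨σ, hσ, hl⟩ := exists_mem_of_K_le hk.ge
  rw [← hk] at h
  norm_cast at h
  exact ⟨σ, hσ, by omega⟩

theorem isAntichainStr_dom {u : OracleCode} (hu : PrefixFreeMachine u) (O : ℕ → ℕ) :
    IsAntichainStr {σ | (evalStr u O σ).Dom} :=
  fun σ hσ τ hτ h => hu O σ τ h hσ hτ

theorem mu_Cyl_compressible_le {u : OracleCode} (hu : PrefixFreeMachine u) (O : ℕ → ℕ) (d : ℕ) :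
    mu (Cyl (compressible u O d)) ≤ 2⁻¹ ^ d := by
  calc mu (Cyl (compressible u O d)) ≤ ∑' ρ : compressible u O d, wt ρ := mu_Cyl_le _
    _ ≤ ∑' σ : {σ | (evalStr u O σ).Dom}, 2⁻¹ ^ d * wt σ := by
      refine tsum_le_tsum_of_section (fun ρ σ => (ρ : List Bool) ∈ evalStr u O σ)
        (fun ρ ρ' σ h h' => Subtype.ext (Part.mem_unique h h')) ?_
      rintro ⟨ρ, σ, hσ, hl⟩ -
      refine ⟨⟨σ, Part.dom_iff_mem.2 ⟨ρ, hσ⟩⟩, hσ, ?_⟩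
      rw [wt, wt, ← pow_add]
      exact inv_two_pow_anti (by simpa [add_comm] using hl)
    _ ≤ 2⁻¹ ^ d := by
      rw [ENNReal.tsum_mul_left]
      exact mul_le_of_le_one_right' (tsum_wt_le_one (isAntichainStr_dom hu O))

theorem ceSeqIn_compressible (u : OracleCode) (A : Set ℕ) :
    CeSeqIn A (compressible u (chi A)) := by
  obtain ⟨f, hf, -, hs⟩ := exists_approx_evalStr u
  have hQ : PrimrecPred fun p : List ℕ × ℕ × List Bool => ∃ j < p.2.2.length + 1,
      j + p.2.1 ≤ p.2.2.length ∧ ∃ σ ∈ allStr j, f p.1 σ = some p.2.2 := by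
    refine primrecPred_exists_lt (Primrec.succ.comp (Primrec.list_length.comp
      (Primrec.snd.comp Primrec.snd))) (PrimrecPred.and ?_ ?_)
    · exact Primrec.nat_le.comp (Primrec.nat_add.comp Primrec.snd
        (Primrec.fst.comp (Primrec.snd.comp Primrec.fst)))
        (Primrec.list_length.comp (Primrec.snd.comp (Primrec.snd.comp Primrec.fst)))
    · refine primrecPred_exists_mem (primrec_allStr.comp Primrec.snd) ?_
      exact Primrec.eq.comp (hf.comp (Primrec.fst.comp (Primrec.fst.comp Primrec.fst)) Primrec.snd)
        (Primrec.option_some.comp (Primrec.snd.comp (Primrec.snd.comp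
          (Primrec.fst.comp Primrec.fst))))
  convert ceSeqIn_of_stage (A := A) (Q := fun l n ρ => ∃ j < ρ.length + 1,
      j + n ≤ ρ.length ∧ ∃ σ ∈ allStr j, f l σ = some ρ) hQ using 2 with d
  ext ρ
  simp only [compressible, hs, mem_allStr, Set.mem_ofPred_eq]
  constructor
  · rintro ⟨σ, ⟨s, h⟩, hl⟩
    exact ⟨s, σ.length, by omega, hl, σ, rfl, h⟩
  · rintro ⟨s, _, -, hl, σ, rfl, h⟩
    exact ⟨σ, ⟨s, h⟩, hl⟩

theorem not_MLRandom_of_compressible {u : OracleCode} (hu : PrefixFreeMachine u) {A : Set ℕ}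
    {X : ℕ → Bool} (h : ∀ d, ∃ n, pre X n ∈ compressible u (chi A) d) : ¬ MLRandom A X := by
  intro hX
  refine hX (fun d => Cyl (compressible u (chi A) d)) ⟨_, ceSeqIn_compressible u A, fun _ => rfl,
    fun d => Cyl_mono ?_, mu_Cyl_compressible_le hu _⟩ (Set.mem_iInter.2 fun d => mem_Cyl.2 (h d))
  rintro ρ ⟨σ, hσ, hl⟩
  exact ⟨σ, hσ, by omega⟩

/-! ### Antichains generating computably enumerable open sets -/

/-- Some prefix of `ρ` has entered the `k`-th set by stage `|ρ|`. -/
def Hit (Q : List ℕ → ℕ → List Bool → Prop) (l : List ℕ) (k : ℕ) (ρ : List Bool) : Prop :=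
  ∃ j < ρ.length + 1, Q (l.take ρ.length) k (ρ.take j)

/-- `ρ` is minimal with `Hit`. -/
def MinHit (Q : List ℕ → ℕ → List Bool → Prop) (l : List ℕ) (k : ℕ) (ρ : List Bool) : Prop :=
  Hit Q l k ρ ∧ ∀ i < ρ.length, ¬ Hit Q l k (ρ.take i)

theorem primrec_Hit {Q : List ℕ → ℕ → List Bool → Prop}
    (hQ : PrimrecPred fun p : List ℕ × ℕ × List Bool => Q p.1 p.2.1 p.2.2) :
    PrimrecPred fun p : List ℕ × ℕ × List Bool => Hit Q p.1 p.2.1 p.2.2 := by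
  have hρ : Primrec fun p : List ℕ × ℕ × List Bool => p.2.2 := Primrec.snd.comp Primrec.snd
  refine primrecPred_exists_lt (Primrec.succ.comp (Primrec.list_length.comp hρ)) ?_
  refine hQ.comp (Primrec.pair (Primrec.list_take.comp
    (Primrec.list_length.comp (hρ.comp Primrec.fst)) (Primrec.fst.comp Primrec.fst))
    (Primrec.pair (Primrec.fst.comp (Primrec.snd.comp Primrec.fst))
      (Primrec.list_take.comp Primrec.snd (hρ.comp Primrec.fst))))

theorem primrec_MinHit {Q : List ℕ → ℕ → List Bool → Prop}
    (hQ : PrimrecPred fun p : List ℕ × ℕ × List Bool => Q p.1 p.2.1 p.2.2) :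
    PrimrecPred fun p : List ℕ × ℕ × List Bool => MinHit Q p.1 p.2.1 p.2.2 := by
  have hρ : Primrec fun p : List ℕ × ℕ × List Bool => p.2.2 := Primrec.snd.comp Primrec.snd
  refine (primrec_Hit hQ).and (primrecPred_forall_lt (Primrec.list_length.comp hρ) ?_)
  exact ((primrec_Hit hQ).comp (Primrec.pair (Primrec.fst.comp Primrec.fst)
    (Primrec.pair (Primrec.fst.comp (Primrec.snd.comp Primrec.fst))
      (Primrec.list_take.comp Primrec.snd (hρ.comp Primrec.fst))))).not

theorem hit_pre_congr {Q : List ℕ → ℕ → List Bool → Prop} {O : ℕ → ℕ} {k s t : ℕ} {ρ : List Bool}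
    (hs : ρ.length ≤ s) (ht : ρ.length ≤ t) : Hit Q (pre O s) k ρ ↔ Hit Q (pre O t) k ρ := by
  rw [Hit, Hit, take_pre O hs, take_pre O ht]

theorem minHit_pre_congr {Q : List ℕ → ℕ → List Bool → Prop} {O : ℕ → ℕ} {k s t : ℕ}
    {ρ : List Bool} (hs : ρ.length ≤ s) (ht : ρ.length ≤ t) :
    MinHit Q (pre O s) k ρ ↔ MinHit Q (pre O t) k ρ := by
  have h : ∀ i < ρ.length, (Hit Q (pre O s) k (ρ.take i) ↔ Hit Q (pre O t) k (ρ.take i)) :=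
    fun i hi => hit_pre_congr (by simp; omega) (by simp; omega)
  rw [MinHit, MinHit, hit_pre_congr hs ht]
  refine and_congr_right fun _ => forall₂_congr fun i hi => not_congr (h i hi)

/-- The antichain of strings with `MinHit`. -/
def minHits (Q : List ℕ → ℕ → List Bool → Prop) (O : ℕ → ℕ) (k : ℕ) : Set (List Bool) :=
  {ρ | MinHit Q (pre O ρ.length) k ρ}

theorem isAntichainStr_minHits (Q : List ℕ → ℕ → List Bool → Prop) (O : ℕ → ℕ) (k : ℕ) :
    IsAntichainStr (minHits Q O k) := by
  intro σ hσ τ hτ h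
  by_contra hne
  have hlt : σ.length < τ.length := lt_of_le_of_ne h.length_le fun he => hne (h.eq_of_length he)
  refine hτ.2 σ.length hlt ?_
  rw [← List.prefix_iff_eq_take.1 h]
  exact (hit_pre_congr le_rfl h.length_le).1 hσ.1

theorem Cyl_minHits {Q : List ℕ → ℕ → List Bool → Prop} {O : ℕ → ℕ} {W : ℕ → Set (List Bool)}
    (hmono : ∀ {s t : ℕ} (n : ℕ) (σ : List Bool), s ≤ t → Q (pre O s) n σ → Q (pre O t) n σ)
    (hQ : ∀ n σ, σ ∈ W n ↔ ∃ s, Q (pre O s) n σ) (k : ℕ) : Cyl (minHits Q O k) = Cyl (W k) := by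
  classical
  ext X
  rw [mem_Cyl, mem_Cyl]
  constructor
  · rintro ⟨n, ⟨j, hj, h⟩, -⟩
    simp only [length_pre] at h hj
    rw [take_pre X (by omega), take_pre O le_rfl] at h
    exact ⟨j, (hQ _ _).2 ⟨_, h⟩⟩
  · rintro ⟨n, hn⟩
    obtain ⟨s, hs⟩ := (hQ _ _).1 hn
    have hex : ∃ m, Hit Q (pre O m) k (pre X m) := by
      refine ⟨max n s, n, by simp, ?_⟩
      rw [length_pre, take_pre O le_rfl, take_pre X (le_max_left _ _)]
      exact hmono _ _ (le_max_right _ _) hs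
    refine ⟨Nat.find hex, ?_, fun i hi => ?_⟩
    · rw [length_pre]
      exact Nat.find_spec hex
    · rw [length_pre] at hi
      rw [length_pre, take_pre X hi.le, hit_pre_congr (s := Nat.find hex) (t := i)
        ((length_pre X i).trans_le hi.le) (length_pre X i).le]
      exact Nat.find_min hex hi

theorem exists_compressible_of_not_MLRandom {u : OracleCode} (hu : UniversalPFM u) {A : Set ℕ}
    {X : ℕ → Bool} (hX : ¬ MLRandom A X) (d : ℕ) : ∃ n, K u (chi A) (pre X n) + d ≤ n := by
  classical
  simp only [MLRandom, not_forall, not_not] at hX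
  obtain ⟨U, ⟨W, hW, hU, -, hmu⟩, hX⟩ := hX
  obtain ⟨Q, hQp, hmono, hQ⟩ := hW.exists_stage
  have hcyl : ∀ k, Cyl (minHits Q (chi A) k) = U k := fun k =>
    (Cyl_minHits (hmono _) hQ k).trans (hU k).symm
  have hP : PrimrecRel fun (l : List ℕ) (i : ℕ × List Bool) => MinHit Q l (2 * i.1 + 2) i.2 :=
    (primrec_MinHit hQp).comp (Primrec.pair Primrec.fst (Primrec.pair
      (Primrec.nat_add.comp (Primrec.nat_mul.comp (Primrec.const 2)
        (Primrec.fst.comp Primrec.snd)) (Primrec.const 2)) (Primrec.snd.comp Primrec.snd)))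
  obtain ⟨e, he⟩ := hu.exists_K_le_of_index hP (len := fun i => i.2.length - i.1)
    (Primrec.nat_sub.comp (Primrec.list_length.comp Primrec.snd) Primrec.fst)
    (str := Prod.snd) Primrec.snd
  have hle : ∀ i : ℕ × List Bool, i.2.length ≤ Encodable.encode i := fun i =>
    (Encodable.length_le_encode i.2).trans (Nat.right_le_pair _ _)
  have hiff : ∀ i : ℕ × List Bool, MinHit Q (pre (chi A) (Encodable.encode i)) (2 * i.1 + 2) i.2 ↔
      i.2 ∈ minHits Q (chi A) (2 * i.1 + 2) := fun i =>
    minHit_pre_congr (hle i) le_rfl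
  have hwt : ∀ k, ∑' ρ : minHits Q (chi A) k, wt ρ ≤ 2⁻¹ ^ k := fun k => by
    rw [← mu_Cyl_eq (isAntichainStr_minHits _ _ _), hcyl]
    exact hmu k
  have hsum : (∑' i : ℕ × List Bool, if MinHit Q (pre (chi A) (Encodable.encode i)) (2 * i.1 + 2) i.2
      then (2⁻¹ : ℝ≥0∞) ^ (i.2.length - i.1) else 0) ≤ 1 := by
    simp only [hiff]
    rw [ENNReal.tsum_prod (f := fun (k : ℕ) (ρ : List Bool) =>
      if ρ ∈ minHits Q (chi A) (2 * k + 2) then (2⁻¹ : ℝ≥0∞) ^ (ρ.length - k) else 0)]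
    have hk : ∀ k : ℕ, (∑' ρ : List Bool, if ρ ∈ minHits Q (chi A) (2 * k + 2) then
        (2⁻¹ : ℝ≥0∞) ^ (ρ.length - k) else 0) ≤ 2⁻¹ ^ (k + 1) := by
      intro k
      have hcan : (2 : ℝ≥0∞) ^ k * 2⁻¹ ^ k = 1 := by
        rw [← mul_pow, ENNReal.mul_inv_cancel two_ne_zero ENNReal.ofNat_ne_top, one_pow]
      calc _ ≤ ∑' ρ : List Bool, 2 ^ k * (minHits Q (chi A) (2 * k + 2)).indicator wt ρ := by
            refine ENNReal.tsum_le_tsum fun ρ => ?_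
            split_ifs with h
            · rw [Set.indicator_of_mem h, wt]
              calc (2⁻¹ : ℝ≥0∞) ^ (ρ.length - k)
                  = 2 ^ k * 2⁻¹ ^ k * 2⁻¹ ^ (ρ.length - k) := by rw [hcan, one_mul]
                _ = 2 ^ k * 2⁻¹ ^ (k + (ρ.length - k)) := by rw [pow_add, mul_assoc]
                _ ≤ 2 ^ k * 2⁻¹ ^ ρ.length := by
                  gcongr 2 ^ k * ?_
                  exact inv_two_pow_anti (by omega)
            · exact zero_le
        _ = 2 ^ k * ∑' ρ : minHits Q (chi A) (2 * k + 2), wt ρ := by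
            rw [ENNReal.tsum_mul_left, tsum_subtype]
        _ ≤ 2 ^ k * 2⁻¹ ^ (2 * k + 2) := by
            gcongr
            exact hwt _
        _ = 2 ^ k * 2⁻¹ ^ k * 2⁻¹ ^ (k + 2) := by
            rw [mul_assoc, ← pow_add]
            congr 2
            omega
        _ = 2⁻¹ ^ (k + 2) := by rw [hcan, one_mul]
        _ ≤ 2⁻¹ ^ (k + 1) :=
            inv_two_pow_anti (by omega)
    refine (ENNReal.tsum_le_tsum hk).trans_eq ?_
    rw [ENNReal.tsum_geometric_add_one]
    simp [ENNReal.one_sub_inv_two, ENNReal.inv_mul_cancel]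
  set k := e + d
  have hXk : X ∈ Cyl (minHits Q (chi A) (2 * k + 2)) := by
    rw [hcyl]
    exact Set.mem_iInter.1 hX _
  obtain ⟨n, hn⟩ := mem_Cyl.1 hXk
  have hkn : k ≤ n := by
    have h1 : wt (pre X n) ≤ 2⁻¹ ^ (2 * k + 2) :=
      (ENNReal.le_tsum (f := fun ρ : minHits Q (chi A) (2 * k + 2) => wt ρ) ⟨_, hn⟩).trans (hwt _)
    by_contra hlt
    rw [wt, length_pre] at h1
    have := le_of_inv_two_pow_le h1
    omega
  refine ⟨n, ?_⟩
  have := he (chi A) hsum (k, pre X n) ((hiff _).2 hn)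
  simp only [length_pre] at this
  refine (add_le_add_left this _).trans ?_
  norm_cast
  omega

theorem MLRandom_of_lowForK {u : OracleCode} (hu : UniversalPFM u) {A : Set ℕ} {c : ℕ}
    (hc : ∀ τ : List Bool, K u (chi ∅) τ ≤ K u (chi A) τ + (c : ℕ∞)) {X : ℕ → Bool}
    (hX : MLRandom ∅ X) : MLRandom A X := by
  by_contra h
  refine not_MLRandom_of_compressible hu.1 (fun d => ?_) hX
  obtain ⟨n, hn⟩ := exists_compressible_of_not_MLRandom hu h (c + d)
  refine ⟨n, mem_compressible_of_K_le ?_⟩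
  rw [length_pre]
  refine (add_le_add_left (hc _) _).trans ?_
  rw [add_assoc]
  exact_mod_cast hn

/-! ### Topology of Cantor space -/

theorem isClosed_pre (p : List Bool → Prop) (n : ℕ) :
    IsClosed {X : ℕ → Bool | p (pre X n)} := by
  have hc : Continuous fun X : ℕ → Bool => fun i : Fin n => X i := by fun_prop
  have h : {X : ℕ → Bool | p (pre X n)} =
      (fun X : ℕ → Bool => fun i : Fin n => X i) ⁻¹' {v | p (List.ofFn v)} := by
    ext X
    simp only [Set.mem_ofPred_eq, Set.mem_preimage]
    rw [show pre X n = List.ofFn fun i : Fin n => X i by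
      refine List.ext_getElem (by simp) fun i h1 h2 => by simp [pre]]
  rw [h]
  exact (isClosed_discrete _).preimage hc

theorem isClosed_cone (σ : List Bool) : IsClosed (cone σ) :=
  isClosed_pre (· = σ) _

theorem isClosed_compl_Cyl (W : Set (List Bool)) : IsClosed (Cyl W)ᶜ := by
  have : (Cyl W)ᶜ = ⋂ n, {X | pre X n ∉ W} := by
    ext X
    simp [mem_Cyl]
  rw [this]
  exact isClosed_iInter fun n => isClosed_pre (· ∉ W) n

theorem nonempty_iInter_of_antitone {C : ℕ → Set (ℕ → Bool)} (hanti : ∀ n, C (n + 1) ⊆ C n)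
    (hne : ∀ n, (C n).Nonempty) (hC : ∀ n, IsClosed (C n)) : (⋂ n, C n).Nonempty :=
  IsCompact.nonempty_iInter_of_sequence_nonempty_isCompact_isClosed C hanti hne
    (hC 0).isCompact hC

theorem cone_append_subset (σ τ : List Bool) : cone (σ ++ τ) ⊆ cone σ := by
  intro X hX
  rw [mem_cone] at hX ⊢
  rw [← take_pre X (show σ.length ≤ (σ ++ τ).length by simp), hX, List.take_left]

/-! ### Powers of sets of strings -/

/-- The concatenations of `n` strings in `W`. -/
def strPow (W : Set (List Bool)) (n : ℕ) : Set (List Bool) :=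
  {σ | ∃ L : List (List Bool), L.length = n ∧ L.flatten = σ ∧ ∀ w ∈ L, w ∈ W}

theorem mem_strPow_succ {W : Set (List Bool)} {n : ℕ} {σ : List Bool} :
    σ ∈ strPow W (n + 1) ↔ ∃ τ ∈ strPow W n, ∃ w ∈ W, σ = τ ++ w := by
  constructor
  · rintro ⟨L, hl, rfl, hL⟩
    obtain ⟨L, w, rfl⟩ := (List.eq_nil_or_concat' L).resolve_left (by rintro rfl; simp at hl)
    exact ⟨L.flatten, ⟨L, by simpa using hl, rfl, fun v hv => hL v (by simp [hv])⟩, w,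
      hL w (by simp), by simp⟩
  · rintro ⟨_, ⟨L, hl, rfl, hL⟩, w, hw, rfl⟩
    refine ⟨L ++ [w], by simp [hl], by simp, fun v hv => ?_⟩
    rcases List.mem_append.1 hv with h | h
    · exact hL v h
    · rwa [List.mem_singleton.1 h]

theorem tsum_strPow_le (W : Set (List Bool)) (n : ℕ) :
    ∑' σ : strPow W n, wt σ ≤ (∑' w : W, wt w) ^ n := by
  induction n with
  | zero =>
    have : strPow W 0 = {[]} := by
      ext σ
      simp [strPow, eq_comm]
    rw [this]
    simp [wt]
  | succ n ih =>
    calc ∑' σ : strPow W (n + 1), wt σ ≤ ∑' p : strPow W n × W, wt p.1 * wt p.2 := by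
          refine tsum_le_tsum_of_section (fun σ p => (σ : List Bool) = p.1 ++ p.2)
            (fun _ _ _ h h' => Subtype.ext (h.trans h'.symm)) ?_
          rintro ⟨σ, hσ⟩ -
          obtain ⟨τ, hτ, w, hw, rfl⟩ := mem_strPow_succ.1 hσ
          exact ⟨(⟨τ, hτ⟩, ⟨w, hw⟩), rfl, by simp [wt, pow_add]⟩
      _ = (∑' σ : strPow W n, wt σ) * ∑' w : W, wt w := by
          rw [ENNReal.tsum_prod (f := fun (σ : strPow W n) (w : W) => wt σ * wt w)]
          simp only [ENNReal.tsum_mul_left, ENNReal.tsum_mul_right]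
      _ ≤ _ := by
          rw [pow_succ]
          gcongr

theorem ceSeqIn_strPow {A : Set ℕ} {W : Set (List Bool)} {Q : List ℕ → List Bool → Prop}
    (hQp : PrimrecRel Q)
    (hmono : ∀ {s t : ℕ} (σ : List Bool), s ≤ t → Q (pre (chi A) s) σ → Q (pre (chi A) t) σ)
    (hQ : ∀ σ, σ ∈ W ↔ ∃ s, Q (pre (chi A) s) σ) : CeSeqIn A (strPow W) := by
  have hp : PrimrecPred fun p : List ℕ × ℕ × List Bool => ∃ m < p.1.length,
      ∃ L ∈ (Encodable.decode (α := List (List Bool)) m).toList,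
        L.length = p.2.1 ∧ L.flatten = p.2.2 ∧ ∀ w ∈ L, Q p.1 w := by
    refine primrecPred_exists_lt (Primrec.list_length.comp Primrec.fst) ?_
    refine primrecPred_exists_mem (Primrec.optionToList.comp
      (Primrec.decode.comp Primrec.snd)) (PrimrecPred.and ?_ (PrimrecPred.and ?_ ?_))
    · exact Primrec.eq.comp (Primrec.list_length.comp Primrec.snd)
        (Primrec.fst.comp (Primrec.snd.comp (Primrec.fst.comp Primrec.fst)))
    · exact Primrec.eq.comp (Primrec.list_flatten.comp Primrec.snd)
        (Primrec.snd.comp (Primrec.snd.comp (Primrec.fst.comp Primrec.fst)))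
    · exact primrecPred_forall_mem Primrec.snd (hQp.comp
        (Primrec.fst.comp (Primrec.fst.comp (Primrec.fst.comp Primrec.fst))) Primrec.snd)
  convert ceSeqIn_of_stage (A := A) (Q := fun l n σ => ∃ m < l.length,
      ∃ L ∈ (Encodable.decode (α := List (List Bool)) m).toList,
        L.length = n ∧ L.flatten = σ ∧ ∀ w ∈ L, Q l w) hp using 2 with n
  ext σ
  simp only [strPow, Set.mem_ofPred_eq, length_pre]
  constructor
  · rintro ⟨L, hl, hf, hL⟩
    choose! s hs using fun w hw => (hQ w).1 (hL w hw)
    have hb : ∀ w ∈ L, s w ≤ (L.map s).sum := fun w hw =>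
      List.single_le_sum (fun _ _ => Nat.zero_le _) _ (List.mem_map_of_mem hw)
    exact ⟨(L.map s).sum + Encodable.encode L + 1, Encodable.encode L, by omega, L, by simp, hl, hf,
      fun w hw => hmono w (by have := hb w hw; omega) (hs w hw)⟩
  · rintro ⟨s, m, -, L, -, hl, hf, hL⟩
    exact ⟨L, hl, hf, fun w hw => (hQ w).2 ⟨s, hL w hw⟩⟩

theorem exists_cone_append_subset {A : Set ℕ} {W : Set (List Bool)}
    (hW : CeSeqIn A (strPow W)) (hwt : ∑' w : W, wt w ≤ 2⁻¹) {S : Set (List Bool)}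
    (hS : mu (Cyl S) < 1) (hrand : ∀ X ∉ Cyl S, MLRandom A X) :
    ∃ σ, ¬ cone σ ⊆ Cyl S ∧ ∀ w ∈ W, cone (σ ++ w) ⊆ Cyl S := by
  by_contra! hc
  choose! f hfW hf using hc
  set s : ℕ → List Bool := Nat.rec [] fun _ σ => σ ++ f σ with hs
  have hns : ∀ n, ¬ cone (s n) ⊆ Cyl S := by
    intro n
    induction n with
    | zero =>
      intro h
      have h1 := measure_mono (μ := mu) h
      rw [mu_cone] at h1
      exact absurd (h1.trans_lt hS) (by simp [hs])
    | succ n ih => exact hf _ ih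
  have hpow : ∀ n, s n ∈ strPow W n := by
    intro n
    induction n with
    | zero => exact ⟨[], rfl, rfl, by simp⟩
    | succ n ih => exact mem_strPow_succ.2 ⟨_, ih, _, hfW _ (hns n), rfl⟩
  obtain ⟨X, hX⟩ := nonempty_iInter_of_antitone (C := fun n => cone (s n) ∩ (Cyl S)ᶜ)
    (fun n => Set.inter_subset_inter_left _ (cone_append_subset _ _))
    (fun n => Set.not_subset.1 (hns n))
    (fun n => (isClosed_cone _).inter (isClosed_compl_Cyl S))
  rw [Set.mem_iInter] at hX
  refine hrand X (hX 0).2 (fun n => Cyl (strPow W n)) ⟨_, hW, fun _ => rfl, fun n => ?_, fun n => ?_⟩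
    (Set.mem_iInter.2 fun n => mem_Cyl.2 ⟨(s n).length, ?_⟩)
  · intro Y hY
    obtain ⟨m, hm⟩ := mem_Cyl.1 hY
    obtain ⟨τ, hτ, w, -, h⟩ := mem_strPow_succ.1 hm
    have : Y ∈ cone (τ ++ w) := by rw [mem_cone, ← h, length_pre]
    exact mem_Cyl.2 ⟨τ.length, by rwa [mem_cone.1 (cone_append_subset _ _ this)]⟩
  · exact (mu_Cyl_le _).trans ((tsum_strPow_le W n).trans (pow_le_pow_left' hwt n))
  · rw [mem_cone.1 (hX n).1]
    exact hpow n

/-! ### Strings guaranteeing a block of ones -/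

/-- The strings of length `⟨i, n⟩` forcing membership in `block i n`. -/
def blockStr (i n : ℕ) : Set (List Bool) :=
  {w | w.length = Nat.pair i n ∧ ∀ j < n, w[Nat.pair i j]? = some true}

theorem pre_mem_blockStr {i n : ℕ} {X : ℕ → Bool} :
    pre X (Nat.pair i n) ∈ blockStr i n ↔ X ∈ block i n := by
  simp only [blockStr, block, Set.mem_ofPred_eq, length_pre, true_and]
  refine forall₂_congr fun j hj => ?_
  rw [getElem?_pre X (Nat.pair_lt_pair_right i hj), Option.some_inj]

theorem Cyl_blockStr (i n : ℕ) : Cyl (blockStr i n) = block i n := by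
  ext X
  rw [mem_Cyl, ← pre_mem_blockStr]
  refine ⟨fun ⟨m, hm⟩ => ?_, fun h => ⟨_, h⟩⟩
  have : m = Nat.pair i n := by simpa using hm.1
  rwa [← this]

theorem mu_block (i n : ℕ) : mu (block i n) = 2⁻¹ ^ n := by
  have h := mu_biInter_compl_block (fun _ => n) {i}
  simp only [Finset.mem_singleton, Set.iInter_iInter_eq_left, Finset.prod_singleton] at h
  have hm : MeasurableSet (block i n) := by
    rw [← Cyl_blockStr]
    exact measurableSet_Cyl _
  rw [prob_compl_eq_one_sub hm] at h
  have h1 : (2⁻¹ : ℝ≥0∞) ^ n ≤ 1 := pow_le_one' (ENNReal.inv_le_one.2 one_le_two) n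
  rw [← ENNReal.sub_sub_cancel ENNReal.one_ne_top (prob_le_one (μ := mu) (s := block i n)), h,
    ENNReal.sub_sub_cancel ENNReal.one_ne_top h1]

theorem tsum_blockStr (i n : ℕ) : ∑' w : blockStr i n, wt w = 2⁻¹ ^ n := by
  rw [← mu_Cyl_eq, Cyl_blockStr, mu_block]
  exact fun σ hσ τ hτ h => h.eq_of_length (hσ.1.trans hτ.1.symm)

/-- The strings forcing the block of ones coding some description by `u` with oracle `O`. -/
def codeStr (u : OracleCode) (O : ℕ → ℕ) : Set (List Bool) :=
  {w | ∃ (p : List Bool × ℕ) (σ : List Bool), p.1 ∈ evalStr u O σ ∧ p.2 = σ.length + 2 ∧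
    w ∈ blockStr (Encodable.encode p) p.2}

theorem tsum_codeStr_le {u : OracleCode} (hu : PrefixFreeMachine u) (O : ℕ → ℕ) :
    ∑' w : codeStr u O, wt w ≤ 2⁻¹ := by
  have h : codeStr u O = ⋃ σ : {σ | (evalStr u O σ).Dom},
      blockStr (Encodable.encode ((evalStr u O σ).get σ.2, (σ : List Bool).length + 2))
        ((σ : List Bool).length + 2) := by
    ext w
    simp only [codeStr, Set.mem_ofPred_eq, Set.mem_iUnion, Prod.exists]
    constructor
    · rintro ⟨τ, _, σ, hτ, rfl, hw⟩
      refine ⟨⟨σ, Part.dom_iff_mem.2 ⟨τ, hτ⟩⟩, ?_⟩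
      rwa [Part.get_eq_of_mem hτ]
    · rintro ⟨⟨σ, hσ⟩, hw⟩
      exact ⟨_, _, σ, Part.get_mem hσ, rfl, hw⟩
  rw [h]
  refine (ENNReal.tsum_iUnion_le_tsum _ _).trans ?_
  simp only [tsum_blockStr]
  calc ∑' σ : {σ | (evalStr u O σ).Dom}, (2⁻¹ : ℝ≥0∞) ^ ((σ : List Bool).length + 2)
      ≤ ∑' σ : {σ | (evalStr u O σ).Dom}, 2⁻¹ * wt σ := by
        refine ENNReal.tsum_le_tsum fun σ => ?_
        rw [wt, ← pow_succ']
        exact inv_two_pow_anti (by omega)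
    _ ≤ 2⁻¹ := by
        rw [ENNReal.tsum_mul_left]
        exact mul_le_of_le_one_right' (tsum_wt_le_one (isAntichainStr_dom hu O))

theorem ceSeqIn_strPow_codeStr (u : OracleCode) (A : Set ℕ) :
    CeSeqIn A (strPow (codeStr u (chi A))) := by
  obtain ⟨f, hf, hmono, hs⟩ := exists_approx_evalStr u
  refine ceSeqIn_strPow (Q := fun l w =>
    ∃ p ∈ (Encodable.decode (α := List Bool × ℕ) w.length.unpair.1).toList,
      (∃ σ ∈ allStr (p.2 - 2), p.2 = σ.length + 2 ∧ f l σ = some p.1) ∧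
      w.length = Nat.pair (Encodable.encode p) p.2 ∧
      ∀ j < p.2, w[Nat.pair (Encodable.encode p) j]? = some true) ?_ ?_ ?_
  · refine primrecPred_exists_mem (Primrec.optionToList.comp (Primrec.decode.comp (Primrec.fst.comp
      (Primrec.unpair.comp (Primrec.list_length.comp Primrec.snd)))))
      (PrimrecPred.and ?_ (PrimrecPred.and ?_ ?_))
    · have hp : Primrec fun x : ((List ℕ × List Bool) × List Bool × ℕ) × List Bool => x.1.2 :=
        Primrec.snd.comp Primrec.fst
      refine primrecPred_exists_mem (primrec_allStr.comp (Primrec.nat_sub.comp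
        (Primrec.snd.comp Primrec.snd) (Primrec.const 2))) (PrimrecPred.and ?_ ?_)
      · exact Primrec.eq.comp (Primrec.snd.comp hp)
          (Primrec.nat_add.comp (Primrec.list_length.comp Primrec.snd) (Primrec.const 2))
      · exact Primrec.eq.comp (hf.comp (Primrec.fst.comp (Primrec.fst.comp Primrec.fst))
          Primrec.snd) (Primrec.option_some.comp (Primrec.fst.comp hp))
    · exact Primrec.eq.comp (Primrec.list_length.comp (Primrec.snd.comp Primrec.fst))
        (Primrec₂.natPair.comp (Primrec.encode.comp Primrec.snd) (Primrec.snd.comp Primrec.snd))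
    · refine primrecPred_forall_lt (Primrec.snd.comp Primrec.snd) ?_
      exact Primrec.eq.comp (Primrec.list_getElem?.comp
        (Primrec.snd.comp (Primrec.fst.comp Primrec.fst)) (Primrec₂.natPair.comp
          (Primrec.encode.comp (Primrec.snd.comp Primrec.fst)) Primrec.snd))
        (Primrec.const (some true))
  · rintro s t w hst ⟨p, hp, ⟨σ, hσ, hl, h⟩, hw⟩
    exact ⟨p, hp, ⟨σ, hσ, hl, hmono _ _ _ hst h⟩, hw⟩
  · intro w
    simp only [codeStr, hs, Set.mem_ofPred_eq]
    constructor
    · rintro ⟨p, σ, ⟨s, h⟩, hp, hw⟩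
      exact ⟨s, p, by simp [hw.1], ⟨σ, mem_allStr.2 (by omega), hp, h⟩, hw⟩
    · rintro ⟨s, p, -, ⟨σ, -, hp, h⟩, hw⟩
      exact ⟨p, σ, ⟨s, h⟩, hp, hw⟩

/-! ### Effectively null sections of `Π⁰₁` classes -/

/-- The sequence `σ` followed by `Y`. -/
def cat (σ : List Bool) (Y : ℕ → Bool) : ℕ → Bool := fun k => σ.getD k (Y (k - σ.length))

theorem pre_cat (σ : List Bool) (Y : ℕ → Bool) (m : ℕ) :
    pre (cat σ Y) (σ.length + m) = σ ++ pre Y m := by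
  refine List.ext_getElem (by simp) fun i h1 h2 => ?_
  simp only [pre, List.getElem_map, List.getElem_range, cat, List.getElem_append]
  split_ifs with h
  · simp [h]
  · simp [List.getElem?_eq_none (not_lt.1 h)]

theorem cat_mem_cone (σ : List Bool) (Y : ℕ → Bool) (m : ℕ) : cat σ Y ∈ cone (σ ++ pre Y m) := by
  rw [mem_cone, List.length_append, length_pre, pre_cat]

theorem cat_shift {σ : List Bool} {X : ℕ → Bool} (hX : X ∈ cone σ) :
    cat σ (fun k => X (σ.length + k)) = X := by
  funext k
  rw [cat]
  rcases lt_or_ge k σ.length with h | h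
  · have := getElem?_pre X h
    rw [mem_cone.1 hX] at this
    rw [List.getD_eq_getElem?_getD, this, Option.getD_some]
  · rw [List.getD_eq_default _ _ h, Nat.add_sub_cancel' h]

/-- No initial segment of `ξ` has been enumerated by stage `l`. -/
def Clear (Q : List ℕ → List Bool → Prop) (l : List ℕ) (ξ : List Bool) : Prop :=
  ∀ j < ξ.length + 1, ¬ Q l (ξ.take j)

theorem primrec_Clear {Q : List ℕ → List Bool → Prop} (hQ : PrimrecRel Q) :
    PrimrecRel (Clear Q) := by
  refine primrecPred_forall_lt (Primrec.succ.comp (Primrec.list_length.comp Primrec.snd))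
    (PrimrecPred.not ?_)
  exact hQ.comp (Primrec.fst.comp Primrec.fst)
    (Primrec.list_take.comp Primrec.snd (Primrec.snd.comp Primrec.fst))

section Stage
variable {Q : List ℕ → List Bool → Prop} {O : ℕ → ℕ} {S : Set (List Bool)}

theorem Clear.anti (hmono : ∀ {s t : ℕ} τ, s ≤ t → Q (pre O s) τ → Q (pre O t) τ) {s t : ℕ}
    (hst : s ≤ t) {ξ ξ' : List Bool} (h : Clear Q (pre O t) ξ) (hξ : ξ' <+: ξ) :
    Clear Q (pre O s) ξ' := by
  intro j hj hq
  have hl := hξ.length_le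
  refine h j (by omega) (hmono _ hst ?_)
  rwa [List.prefix_iff_eq_take.1 hξ, List.take_take, min_eq_left (by omega)] at hq

/-- The sequences `Y` for which `σ` followed by `Y` has not left the class by stage `s`. -/
def surv (Q : List ℕ → List Bool → Prop) (O : ℕ → ℕ) (σ : List Bool) (s : ℕ) : Set (ℕ → Bool) :=
  {Y | Clear Q (pre O s) (σ ++ pre Y s)}

theorem surv_anti (hmono : ∀ {s t : ℕ} τ, s ≤ t → Q (pre O s) τ → Q (pre O t) τ)
    (σ : List Bool) : Antitone (surv Q O σ) := by
  intro s t hst Y hY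
  refine Clear.anti hmono hst hY ?_
  rw [List.prefix_append_right_inj, ← take_pre Y hst]
  exact ⟨_, List.take_append_drop _ _⟩

theorem iInter_surv (hmono : ∀ {s t : ℕ} τ, s ≤ t → Q (pre O s) τ → Q (pre O t) τ)
    (hS : ∀ τ, τ ∈ S ↔ ∃ s, Q (pre O s) τ) (σ : List Bool) :
    ⋂ s, surv Q O σ s = {Y | cat σ Y ∉ Cyl S} := by
  ext Y
  simp only [Set.mem_iInter, surv, Set.mem_ofPred_eq, ← pre_cat]
  constructor
  · intro h hc
    obtain ⟨n, hn⟩ := mem_Cyl.1 hc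
    obtain ⟨s, hs⟩ := (hS _).1 hn
    have hle := le_max_right s n
    refine h (max s n) n (by simp; omega) (hmono _ (le_max_left _ _) ?_)
    rwa [take_pre _ (by omega)]
  · intro h s j hj hq
    rw [length_pre] at hj
    rw [take_pre _ (by omega)] at hq
    exact h (mem_Cyl.2 ⟨j, (hS _).2 ⟨s, hq⟩⟩)

theorem nodup_allStr (n : ℕ) : (allStr n).Nodup := by
  induction n with
  | zero => simp [allStr]
  | succ n ih =>
    rw [show allStr (n + 1) = (allStr n).flatMap fun σ => [σ ++ [false], σ ++ [true]] from rfl,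
      List.nodup_flatMap]
    refine ⟨fun σ _ => by simp, ih.imp fun {σ τ} hne => ?_⟩
    rw [Function.onFun, List.disjoint_left]
    intro ρ h1 h2
    simp only [List.mem_cons, List.not_mem_nil, or_false] at h1 h2
    rcases h1 with rfl | rfl <;> rcases h2 with h | h <;> simp_all

open Classical in
/-- The strings `ρ` of length `s` for which `σ ++ ρ` is clear at stage `s`. -/
noncomputable def live (Q : List ℕ → List Bool → Prop) (σ : List Bool) (l : List ℕ) (s : ℕ) :
    List (List Bool) :=
  (allStr s).filter fun ρ => Clear Q (l.take s) (σ ++ ρ)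

theorem mem_live {σ ρ : List Bool} {l : List ℕ} {s : ℕ} :
    ρ ∈ live Q σ l s ↔ ρ.length = s ∧ Clear Q (l.take s) (σ ++ ρ) := by
  simp [live, mem_allStr]

theorem primrec_live (hQ : PrimrecRel Q) (σ : List Bool) : Primrec₂ (live Q σ) := by
  classical
  have h : PrimrecRel fun (p : List ℕ × ℕ) (ρ : List Bool) => Clear Q (p.1.take p.2) (σ ++ ρ) :=
    (primrec_Clear hQ).comp (Primrec.list_take.comp (Primrec.snd.comp Primrec.fst)
      (Primrec.fst.comp Primrec.fst)) (Primrec.list_append.comp (Primrec.const σ) Primrec.snd)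
  refine (Primrec.listFilterMap (f := fun p : List ℕ × ℕ => allStr p.2)
    (g := fun p ρ => if Clear Q (p.1.take p.2) (σ ++ ρ) then some ρ else none)
    (primrec_allStr.comp Primrec.snd)
    (Primrec.ite h (Primrec.option_some.comp Primrec.snd) (Primrec.const none))).of_eq
    fun p => ?_
  rw [live, ← List.filterMap_eq_filter]
  congr 1
  funext ρ
  simp [Option.guard]

theorem live_pre (σ : List Bool) {s t : ℕ} (h : s ≤ t) :
    live Q σ (pre O t) s = live Q σ (pre O s) s := by
  rw [live, live, take_pre O h, take_pre O le_rfl]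

theorem tsum_eq_length_mul {L : List (List Bool)} (hL : L.Nodup) {w : ℝ≥0∞} {f : List Bool → ℝ≥0∞}
    (hf : ∀ ρ ∈ L, f ρ = w) : ∑' ρ : {ρ | ρ ∈ L}, f ρ = L.length * w := by
  classical
  have : {ρ | ρ ∈ L} = ↑L.toFinset := by ext; simp
  rw [this, Finset.tsum_subtype' L.toFinset, Finset.sum_congr rfl fun ρ hρ => hf ρ (by simpa using hρ),
    Finset.sum_const, List.toFinset_card_of_nodup hL, nsmul_eq_mul]

theorem nodup_live (σ : List Bool) (l : List ℕ) (s : ℕ) : (live Q σ l s).Nodup :=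
  (nodup_allStr s).filter _

theorem mu_surv (σ : List Bool) (s : ℕ) :
    mu (surv Q O σ s) = (live Q σ (pre O s) s).length * 2⁻¹ ^ s := by
  have h : surv Q O σ s = Cyl {ρ | ρ ∈ live Q σ (pre O s) s} := by
    ext Y
    simp only [surv, mem_Cyl, mem_live, Set.mem_ofPred_eq, take_pre O le_rfl, length_pre,
      exists_eq_left]
  rw [h, mu_Cyl_eq]
  · refine tsum_eq_length_mul (nodup_live _ _ _) fun ρ hρ => ?_
    rw [wt, (mem_live.1 hρ).1]
  · exact fun ρ hρ τ hτ h => h.eq_of_length ((mem_live.1 hρ).1.trans (mem_live.1 hτ).1.symm)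

/-- Stage `l` of the `k`-th component of the test that captures the section above `σ` when it is
null. -/
def NullStage (Q : List ℕ → List Bool → Prop) (σ : List Bool) (l : List ℕ) (k : ℕ)
    (ξ : List Bool) : Prop :=
  ∃ s < l.length + 1, (live Q σ l s).length * 2 ^ k ≤ 2 ^ s ∧ ∃ ρ ∈ live Q σ l s, ξ = σ ++ ρ

theorem primrec_NullStage (hQ : PrimrecRel Q) (σ : List Bool) :
    PrimrecPred fun p : List ℕ × ℕ × List Bool => NullStage Q σ p.1 p.2.1 p.2.2 := by
  have hl : Primrec fun x : (List ℕ × ℕ × List Bool) × ℕ => live Q σ x.1.1 x.2 :=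
    (primrec_live hQ σ).comp (Primrec.fst.comp Primrec.fst) Primrec.snd
  refine primrecPred_exists_lt (Primrec.succ.comp (Primrec.list_length.comp Primrec.fst))
    (PrimrecPred.and ?_ ?_)
  · exact Primrec.nat_le.comp (Primrec.nat_mul.comp (Primrec.list_length.comp hl)
      (primrec_pow.comp (Primrec.const 2) (Primrec.fst.comp (Primrec.snd.comp Primrec.fst))))
      (primrec_pow.comp (Primrec.const 2) Primrec.snd)
  · exact primrecPred_exists_mem hl (Primrec.eq.comp
      (Primrec.snd.comp (Primrec.snd.comp (Primrec.fst.comp Primrec.fst)))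
      (Primrec.list_append.comp (Primrec.const σ) Primrec.snd))

theorem nullStage_pre_iff {σ : List Bool} {k : ℕ} {ξ : List Bool} :
    (∃ t, NullStage Q σ (pre O t) k ξ) ↔ ∃ s, (live Q σ (pre O s) s).length * 2 ^ k ≤ 2 ^ s ∧
      ∃ ρ ∈ live Q σ (pre O s) s, ξ = σ ++ ρ := by
  constructor
  · rintro ⟨t, s, hs, h⟩
    rw [length_pre] at hs
    rw [live_pre _ (by omega)] at h
    exact ⟨s, h⟩
  · rintro ⟨s, h⟩
    exact ⟨s, s, by simp, h⟩

theorem mu_surv_le_iff {σ : List Bool} {s k : ℕ} :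
    mu (surv Q O σ s) ≤ 2⁻¹ ^ k ↔ (live Q σ (pre O s) s).length * 2 ^ k ≤ 2 ^ s := by
  rw [mu_surv, ← ENNReal.inv_pow, ← ENNReal.inv_pow, ← div_eq_mul_inv,
    ENNReal.div_le_iff (by positivity) (by finiteness), mul_comm (_⁻¹ : ℝ≥0∞), ← div_eq_mul_inv,
    ENNReal.le_div_iff_mul_le (by simp) (by simp)]
  norm_cast

/-- If the part of a `Π⁰₁` class relative to `A` above `σ` is null, it has no `A`-random member. -/
theorem mu_cat_compl_ne_zero {A : Set ℕ} (hQ : PrimrecRel Q)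
    (hmono : ∀ {s t : ℕ} τ, s ≤ t → Q (pre (chi A) s) τ → Q (pre (chi A) t) τ)
    (hS : ∀ τ, τ ∈ S ↔ ∃ s, Q (pre (chi A) s) τ) {σ : List Bool} {X : ℕ → Bool}
    (hX : MLRandom A X) (hσ : X ∈ cone σ) (hXS : X ∉ Cyl S) :
    mu {Y | cat σ Y ∉ Cyl S} ≠ 0 := by
  intro h0
  set O := chi A
  have hmeas : ∀ s, MeasurableSet (surv Q O σ s) := fun s =>
    measurableSet_pre (fun ρ => Clear Q (pre O s) (σ ++ ρ)) s
  have hlim := tendsto_measure_iInter_atTop (μ := mu) (fun s => (hmeas s).nullMeasurableSet)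
    (surv_anti hmono σ) ⟨0, measure_ne_top _ _⟩
  rw [iInter_surv hmono hS, h0] at hlim
  have hex : ∀ k : ℕ, ∃ s, mu (surv Q O σ s) ≤ 2⁻¹ ^ k := fun k =>
    ((hlim.eventually (Iio_mem_nhds (show (0 : ℝ≥0∞) < 2⁻¹ ^ k by
      rw [← ENNReal.inv_pow]; exact ENNReal.inv_pos.2 (by finiteness)))).exists).imp
      fun s hs => hs.le
  refine hX _ ⟨_, ceSeqIn_of_stage (A := A) (primrec_NullStage hQ σ), fun _ => rfl,
    fun k => Cyl_mono ?_, fun k => ?_⟩ (Set.mem_iInter.2 fun k => mem_Cyl.2 ?_)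
  · intro ξ hξ
    obtain ⟨s, hs, h⟩ := nullStage_pre_iff.1 hξ
    refine nullStage_pre_iff.2 ⟨s, le_trans ?_ hs, h⟩
    exact Nat.mul_le_mul_left _ (Nat.pow_le_pow_right two_pos (Nat.le_succ k))
  · classical
    have hs := Nat.find_spec (hex k)
    have hmin : ∀ s, mu (surv Q O σ s) ≤ 2⁻¹ ^ k → Nat.find (hex k) ≤ s := fun s =>
      Nat.find_min' (hex k)
    set s₀ := Nat.find (hex k)
    have hsub : Cyl {ξ | ∃ s, NullStage Q σ (pre O s) k ξ} ⊆
        Cyl {ξ | ξ ∈ (live Q σ (pre O s₀) s₀).map (σ ++ ·)} := by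
      intro Z hZ
      obtain ⟨n, hn⟩ := mem_Cyl.1 hZ
      obtain ⟨s, h, ρ, hρ, he⟩ := nullStage_pre_iff.1 hn
      have hle := hmin s (mu_surv_le_iff.2 h)
      rw [mem_live, take_pre _ le_rfl] at hρ
      have hn : n = σ.length + s := by
        rw [← length_pre (X := Z) n, he, List.length_append, hρ.1]
      refine mem_Cyl.2 ⟨σ.length + s₀, List.mem_map.2 ⟨ρ.take s₀, ?_, ?_⟩⟩
      · rw [mem_live, take_pre _ le_rfl, List.length_take, hρ.1]
        exact ⟨min_eq_left hle, hρ.2.anti hmono hle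
          ((List.prefix_append_right_inj _).2 (⟨_, List.take_append_drop _ _⟩))⟩
      · rw [← take_pre Z (show σ.length + s₀ ≤ n by omega), he, List.take_length_add_append]
    refine (measure_mono hsub).trans ((mu_Cyl_le _).trans (le_trans ?_ hs))
    rw [tsum_eq_length_mul (w := 2⁻¹ ^ (σ.length + s₀))
      ((nodup_live _ _ _).map (List.append_right_injective σ)), List.length_map, mu_surv]
    · exact mul_le_mul_right (inv_two_pow_anti (by omega)) _
    · intro ξ hξ
      obtain ⟨ρ, hρ, rfl⟩ := List.mem_map.1 hξ
      rw [wt, List.length_append, (mem_live.1 hρ).1]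
  · obtain ⟨s, hs⟩ := hex k
    set Y : ℕ → Bool := fun k => X (σ.length + k) with hY
    have hcat : cat σ Y = X := cat_shift hσ
    have hmem : Y ∈ ⋂ s, surv Q O σ s := by
      rw [iInter_surv hmono hS, Set.mem_ofPred_eq, hcat]
      exact hXS
    refine ⟨σ.length + s, nullStage_pre_iff.2 ⟨s, mu_surv_le_iff.1 hs, pre Y s, ?_, ?_⟩⟩
    · rw [mem_live, take_pre _ le_rfl, length_pre]
      exact ⟨rfl, Set.mem_iInter.1 hmem s⟩
    · rw [← pre_cat, hcat]

end Stage

/-! ### Recognizing that a block is disjoint from a `Π⁰₁` class -/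

/-- By stage `l`, every live string of length `s` contradicts the block of ones coded by `p`. -/
def BlockOut (Q : List ℕ → List Bool → Prop) (σ : List Bool) (l : List ℕ) (s : ℕ)
    (p : List Bool × ℕ) : Prop :=
  ∀ ρ ∈ live Q σ l s, ∃ j < p.2, ρ.getD (Nat.pair (Encodable.encode p) j) true = false

theorem primrec_BlockOut {Q : List ℕ → List Bool → Prop} (hQ : PrimrecRel Q) (σ : List Bool) :
    PrimrecRel fun (l : List ℕ) (x : ℕ × List Bool × ℕ) => BlockOut Q σ l x.1 x.2 := by
  refine primrecPred_forall_mem ((primrec_live hQ σ).comp Primrec.fst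
    (Primrec.fst.comp Primrec.snd)) ?_
  refine primrecPred_exists_lt (Primrec.snd.comp (Primrec.snd.comp (Primrec.snd.comp Primrec.fst)))
    ?_
  exact Primrec.eq.comp ((Primrec.list_getD true).comp (Primrec.snd.comp Primrec.fst)
    (Primrec₂.natPair.comp (Primrec.encode.comp (Primrec.snd.comp (Primrec.snd.comp
      (Primrec.fst.comp Primrec.fst)))) Primrec.snd)) (Primrec.const false)

theorem blockOut_pre_iff {Q : List ℕ → List Bool → Prop} {O : ℕ → ℕ} {σ : List Bool} {s t : ℕ}
    (h : s ≤ t) {p : List Bool × ℕ} : BlockOut Q σ (pre O t) s p ↔ BlockOut Q σ (pre O s) s p := by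
  rw [BlockOut, BlockOut, live_pre σ h]

theorem getD_pre (Y : ℕ → Bool) (s k : ℕ) : (pre Y s).getD k true = true ↔ (k < s → Y k = true) := by
  rcases lt_or_ge k s with h | h
  · rw [List.getD_eq_getElem?_getD, getElem?_pre Y h]
    simp [h]
  · rw [List.getD_eq_default _ _ (by simpa using h)]
    simp [h.not_gt]

theorem exists_blockOut_iff {Q : List ℕ → List Bool → Prop} {O : ℕ → ℕ} {S : Set (List Bool)}
    (hmono : ∀ {s t : ℕ} τ, s ≤ t → Q (pre O s) τ → Q (pre O t) τ)
    (hS : ∀ τ, τ ∈ S ↔ ∃ s, Q (pre O s) τ) (σ : List Bool) (p : List Bool × ℕ) :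
    (∃ s, BlockOut Q σ (pre O s) s p) ↔
      Disjoint {Y | cat σ Y ∉ Cyl S} (block (Encodable.encode p) p.2) := by
  rw [← iInter_surv hmono hS, Set.disjoint_left]
  constructor
  · rintro ⟨s, h⟩ Y hY hb
    have hs := Set.mem_iInter.1 hY s
    obtain ⟨j, hj, h⟩ := h (pre Y s) (mem_live.2 ⟨length_pre _ _, by rwa [take_pre _ le_rfl]⟩)
    rw [(getD_pre _ _ _).2 fun _ => hb j hj] at h
    cases h
  · intro hd
    by_contra! hc
    have hcl : IsClosed (Cyl (blockStr (Encodable.encode p) p.2)) := by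
      have : Cyl (blockStr (Encodable.encode p) p.2) = {Y : ℕ → Bool | pre Y
          (Nat.pair (Encodable.encode p) p.2) ∈ blockStr (Encodable.encode p) p.2} := by
        rw [Cyl_blockStr]
        ext Y
        exact pre_mem_blockStr.symm
      rw [this]
      exact isClosed_pre (· ∈ blockStr (Encodable.encode p) p.2) _
    have hne : ∀ s, (surv Q O σ s ∩ Cyl (blockStr (Encodable.encode p) p.2)).Nonempty := by
      intro s
      have h := hc s
      simp only [BlockOut, not_forall, not_exists, not_and, Bool.not_eq_false] at h
      obtain ⟨ρ, hρ, h⟩ := h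
      have hpre : pre (fun k => ρ.getD k true) s = ρ := by
        have hl := (mem_live.1 hρ).1
        refine List.ext_getElem (by simp [hl]) fun i h1 h2 => ?_
        simp [pre, h2]
      rw [mem_live, take_pre _ le_rfl] at hρ
      refine ⟨fun k => ρ.getD k true, ?_, ?_⟩
      · rw [surv, Set.mem_ofPred_eq, hpre]
        exact hρ.2
      · rw [Cyl_blockStr]
        exact h
    obtain ⟨Y, hY⟩ := nonempty_iInter_of_antitone
      (fun s => Set.inter_subset_inter_left _ (surv_anti hmono σ (Nat.le_succ s))) hne
      (fun s => (isClosed_pre (fun ρ => Clear Q (pre O s) (σ ++ ρ)) s).inter hcl)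
    rw [Set.mem_iInter] at hY
    refine hd (Set.mem_iInter.2 fun s => (hY s).1) ?_
    rw [← Cyl_blockStr]
    exact (hY 0).2

theorem exists_tsum_le_of_disjoint_block {B : Set (ℕ → Bool)} (hB : mu B ≠ 0) :
    ∃ c : ℕ, ∑' p : {p : List Bool × ℕ | Disjoint B (block (Encodable.encode p) p.2)},
      (2⁻¹ : ℝ≥0∞) ^ (p : List Bool × ℕ).2 ≤ 2 ^ c := by
  set m : ℕ → ℕ := fun i => ((Encodable.decode (α := List Bool × ℕ) i).map Prod.snd).getD 0 with hm
  have hme : ∀ p : List Bool × ℕ, m (Encodable.encode p) = p.2 := fun p => by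
    rw [hm]
    dsimp only
    rw [Encodable.encodek, Option.map_some, Option.getD_some]
  obtain ⟨c, hc⟩ := exists_bound_of_disjoint_block hB m
    (I := {i | Disjoint B (block i (m i))}) fun i hi => hi
  refine ⟨c, ?_⟩
  rw [ENNReal.tsum_eq_iSup_sum]
  refine iSup_le fun F => ?_
  have hinj : Function.Injective fun p : {p : List Bool × ℕ |
      Disjoint B (block (Encodable.encode p) p.2)} => Encodable.encode (p : List Bool × ℕ) :=
    Encodable.encode_injective.comp Subtype.val_injective
  have h := hc (F.map ⟨_, hinj⟩) (by
    intro i hi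
    obtain ⟨p, -, rfl⟩ := Finset.mem_map.1 (Finset.mem_coe.1 hi)
    simpa only [Function.Embedding.coeFn_mk, Set.mem_ofPred_eq, hme] using p.2)
  simpa only [Finset.sum_map, Function.Embedding.coeFn_mk, hme] using h

/-! ### Lowness for randomness implies lowness for `K` -/

theorem K_le_of_lowForRandomness {u : OracleCode} (hu : UniversalPFM u) {A : Set ℕ}
    (hA : ∀ X : ℕ → Bool, MLRandom ∅ X → MLRandom A X) :
    ∃ d : ℕ, ∀ τ : List Bool, K u (chi ∅) τ ≤ K u (chi A) τ + (d : ℕ∞) := by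
  classical
  set S := compressible u (chi ∅) 1 with hS
  have hrand : ∀ X ∉ Cyl S, MLRandom ∅ X := by
    intro X hX
    by_contra hn
    obtain ⟨n, hn⟩ := exists_compressible_of_not_MLRandom hu hn 1
    exact hX (mem_Cyl.2 ⟨n, mem_compressible_of_K_le (by simpa using hn)⟩)
  have hmu : mu (Cyl S) < 1 := (mu_Cyl_compressible_le hu.1 _ _).trans_lt (by simp)
  obtain ⟨σ, hσ, hcode⟩ := exists_cone_append_subset (ceSeqIn_strPow_codeStr u A)
    (tsum_codeStr_le hu.1 _) hmu fun X hX => hA X (hrand X hX)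
  obtain ⟨X, hXσ, hXS⟩ := Set.not_subset.1 hσ
  obtain ⟨Q', hQ', hmono', hQS'⟩ := (ceSeqIn_compressible u ∅).exists_stage
  obtain ⟨Q, hQ, hmono, hQS⟩ : ∃ Q : List ℕ → List Bool → Prop, PrimrecRel Q ∧
      (∀ {s t : ℕ} τ, s ≤ t → Q (pre (chi ∅) s) τ → Q (pre (chi ∅) t) τ) ∧
      ∀ τ, τ ∈ S ↔ ∃ s, Q (pre (chi ∅) s) τ :=
    ⟨fun l τ => Q' l 1 τ, hQ'.comp (Primrec.pair Primrec.fst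
      (Primrec.pair (Primrec.const 1) Primrec.snd)), fun τ => hmono' _ 1 τ, hQS' 1⟩
  have hB := mu_cat_compl_ne_zero hQ hmono hQS (hrand X hXS) hXσ hXS
  obtain ⟨c, hc⟩ := exists_tsum_le_of_disjoint_block hB
  have hiff := exists_blockOut_iff hmono hQS σ
  obtain ⟨d, hd⟩ := hu.exists_K_le_of_index (ι := ℕ × List Bool × ℕ)
    (P := fun l x => BlockOut Q σ l x.1 x.2 ∧ ∀ s < x.1, ¬ BlockOut Q σ l s x.2)
    (len := fun x => x.2.2 + c) (str := fun x => x.2.1)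
    ((primrec_BlockOut hQ σ).and (primrecPred_forall_lt (Primrec.fst.comp Primrec.snd)
      (PrimrecPred.not ((primrec_BlockOut hQ σ).comp (Primrec.fst.comp Primrec.fst)
        (Primrec.pair Primrec.snd (Primrec.snd.comp (Primrec.snd.comp Primrec.fst)))))))
    (Primrec.nat_add.comp (Primrec.snd.comp Primrec.snd) (Primrec.const c))
    (Primrec.fst.comp Primrec.snd)
  have hP : ∀ x : ℕ × List Bool × ℕ,
      (BlockOut Q σ (pre (chi ∅) (Encodable.encode x)) x.1 x.2 ∧
        ∀ s < x.1, ¬ BlockOut Q σ (pre (chi ∅) (Encodable.encode x)) s x.2) ↔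
      (BlockOut Q σ (pre (chi ∅) x.1) x.1 x.2 ∧
        ∀ s < x.1, ¬ BlockOut Q σ (pre (chi ∅) s) s x.2) := by
    intro x
    have hx : x.1 ≤ Encodable.encode x := by
      rw [Encodable.encode_prod_val]
      exact Nat.left_le_pair _ _
    rw [blockOut_pre_iff hx]
    refine and_congr_right' (forall₂_congr fun s hs => ?_)
    rw [blockOut_pre_iff (hs.le.trans hx)]
  replace hd := hd (chi ∅) ?_
  · refine ⟨2 + c + d, fun τ => ?_⟩
    rcases eq_or_ne (K u (chi A) τ) ⊤ with hK | hK
    · simp [hK]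
    obtain ⟨n, hn⟩ := ENat.ne_top_iff_exists.1 hK
    obtain ⟨v, hv, hvn⟩ := exists_mem_of_K_le hn.ge
    have hdis : Disjoint {Y | cat σ Y ∉ Cyl S}
        (block (Encodable.encode (τ, v.length + 2)) (v.length + 2)) := by
      refine Set.disjoint_left.2 fun Y hY hb => hY ?_
      exact hcode _ ⟨(τ, v.length + 2), v, hv, rfl, pre_mem_blockStr.2 hb⟩ (cat_mem_cone σ Y _)
    have hex := (hiff (τ, v.length + 2)).2 hdis
    have h := hd (Nat.find hex, τ, v.length + 2)
      ((hP _).2 ⟨Nat.find_spec hex, fun s hs => Nat.find_min hex hs⟩)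
    refine h.trans ?_
    rw [← hn]
    norm_cast
    simp only
    omega
  · calc _ ≤ ∑' p : {p : List Bool × ℕ | Disjoint {Y | cat σ Y ∉ Cyl S}
          (block (Encodable.encode p) p.2)}, (2⁻¹ : ℝ≥0∞) ^ (p : List Bool × ℕ).2 * 2⁻¹ ^ c := by
          refine tsum_le_tsum_of_section (fun x p => x.2 = p.1 ∧
            BlockOut Q σ (pre (chi ∅) x.1) x.1 x.2 ∧
            ∀ s < x.1, ¬ BlockOut Q σ (pre (chi ∅) s) s x.2) ?_ ?_
          · rintro ⟨s, p⟩ ⟨s', p'⟩ y ⟨h1, h2, h3⟩ ⟨h1', h2', h3'⟩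
            obtain rfl : p = p' := h1.trans h1'.symm
            refine Prod.ext (le_antisymm (not_lt.1 fun h => h3 _ h h2') (not_lt.1 fun h => h3' _ h h2)) rfl
          · intro x hx
            have h := (hP x).1 (by simpa using hx)
            refine ⟨⟨x.2, (hiff x.2).1 ⟨_, h.1⟩⟩, ⟨rfl, h⟩, ?_⟩
            rw [if_pos ((hP x).2 h), pow_add]
    _ ≤ 2 ^ c * 2⁻¹ ^ c := by
      rw [ENNReal.tsum_mul_right]
      exact mul_le_mul_left hc _
    _ = 1 := by
      rw [← mul_pow, ENNReal.mul_inv_cancel two_ne_zero ENNReal.ofNat_ne_top, one_pow]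

end

/-- `A` is low for 1-randomness iff `A` is low for `K`
(for any universal prefix-free oracle machine). -/
theorem lowForRandomness_iff_lowForK (u : OracleCode) (hu : UniversalPFM u) (A : Set ℕ) :
    (∀ X : ℕ → Bool, MLRandom ∅ X → MLRandom A X) ↔
      ∃ d : ℕ, ∀ τ : List Bool, K u (chi ∅) τ ≤ K u (chi A) τ + (d : ℕ∞) :=
  ⟨K_le_of_lowForRandomness hu, fun ⟨_, hc⟩ _ hX => MLRandom_of_lowForK hu hc hX⟩

end LMD
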